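/- arXiv:2508.04069 — 10 statements merged into one kernel-verified Lean document; each statement's English description precedes it below -/
import Mathlib

section
/- Let m be a nonnegative integer and let d, q be real numbers with q ≥ 2 and d ≥ m + 1. Then for every real t ≥ 0 the function g(t) := d·t^{d+q−m−1} − (d+q)·t^{d−m−1} − q·(1+m)·t + q·(2+m) satisfies g(t) ≥ 0. -/
theorem mul_sub_one_le_rpow_sub_one {t q : ℝ} (ht : 0 ≤ t) (hq : 1 ≤ q) :
    q * (t - 1) ≤ t ^ q - 1 := by
  have h := one_add_mul_self_le_rpow_one_add (show -1 ≤ t - 1 by linarith) hq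
  rw [add_sub_cancel] at h
  linarith

theorem mul_sub_one_le_rpow_add_sub_rpow {t a q : ℝ} (ht : 0 ≤ t) (ha : 0 ≤ a) (hq : 1 ≤ q) :
    q * (t - 1) ≤ t ^ (a + q) - t ^ a := by
  have hb := mul_sub_one_le_rpow_sub_one ht hq
  rw [Real.rpow_add_of_nonneg ht ha (by linarith)]
  rcases le_total 1 t with h | h
  · have h1 := Real.one_le_rpow h ha
    have h2 := Real.one_le_rpow h (show 0 ≤ q by linarith)
    nlinarith
  · have h1 := Real.rpow_le_one ht h ha
    have h2 := Real.rpow_le_one ht h (show 0 ≤ q by linarith)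
    nlinarith

theorem add_mul_rpow_le_mul_rpow_add {t a q : ℝ} (ht : 0 ≤ t) (ha : 0 ≤ a) (hq : 0 ≤ q) :
    (a + q) * t ^ a ≤ a * t ^ (a + q) + q := by
  rcases ha.eq_or_lt with rfl | ha
  · simp
  · have hb := mul_sub_one_le_rpow_sub_one (Real.rpow_nonneg ht a)
      (show 1 ≤ (a + q) / a by rw [one_le_div ha]; linarith)
    rw [← Real.rpow_mul ht, mul_div_cancel₀ _ ha.ne', div_mul_eq_mul_div, div_le_iff₀ ha] at hb
    linarith

/-- For a nonnegative integer `m` and reals `q ≥ 2`, `d ≥ m + 1`, and every real `t ≥ 0`,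
the function `g(t) = d·t^{d+q−m−1} − (d+q)·t^{d−m−1} − q·(1+m)·t + q·(2+m)` is nonnegative. -/
theorem poly_laplacian_g_nonneg (m : ℕ) (d q : ℝ)
    (hq : 2 ≤ q) (hd : (m : ℝ) + 1 ≤ d) :
    ∀ t : ℝ, 0 ≤ t →
      d * t ^ (d + q - (m : ℝ) - 1) - (d + q) * t ^ (d - (m : ℝ) - 1)
        - q * (1 + (m : ℝ)) * t + q * (2 + (m : ℝ)) ≥ 0 := by
  intro t ht
  obtain ⟨a, rfl⟩ : ∃ a, d = a + m + 1 := ⟨d - m - 1, by ring⟩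
  have ha : 0 ≤ a := by linarith
  have h1 := mul_le_mul_of_nonneg_left
    (mul_sub_one_le_rpow_add_sub_rpow ht ha (show 1 ≤ q by linarith))
    (show (0 : ℝ) ≤ m + 1 by positivity)
  have h2 := add_mul_rpow_le_mul_rpow_add ht ha (show 0 ≤ q by linarith)
  rw [show a + m + 1 + q - (m : ℝ) - 1 = a + q by ring,
    show a + m + 1 - (m : ℝ) - 1 = a by ring]
  linarith
end

section
/- Let Q ≥ 1 be a real number and let t ≥ 0 satisfy (t+1)⁴ − t⁴ = Q. Then t ≥ −1/2 + 4^{−1/3}·Q^{1/3} − (1/6)·2^{−1/3}·Q^{−1/3} + (1/324)·4^{−1/3}·Q^{−5/3}. -/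
/-- A lower bound for the real root of `s ^ 3 + s / 4 = a ^ 3`, where `b = 1 / (12 * a)`. -/
lemma depressed_cubic_root_lower_bound {a b s : ℝ} (hb : 0 < b) (hb7 : b ≤ 1 / 7)
    (hab : a * b = 1 / 12) (hs : s ^ 3 + s / 4 = a ^ 3) :
    a - b + 48 * b ^ 5 ≤ s := by
  have hbb : b ^ 2 ≤ 1 / 49 := by nlinarith
  have hb4 : b ^ 4 ≤ 1 / 2401 := by nlinarith [sq_nonneg b]
  have key : (a - b + 48 * b ^ 5) ^ 3 + (a - b + 48 * b ^ 5) / 4 ≤ a ^ 3 := by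
    have expand : (a - b + 48 * b ^ 5) ^ 3 + (a - b + 48 * b ^ 5) / 4 - a ^ 3 =
        48 * b ^ 5 * (3 * b ^ 2 + 12 * b ^ 4 - 144 * b ^ 6 + 2304 * b ^ 10 - 1 / 4) := by
      linear_combination (-3 * (a - b) - 288 * b ^ 5 + 144 * b ^ 3 * (a * b + 1 / 12)
        + 3 * 48 ^ 2 * b ^ 9) * hab
    have hneg : 3 * b ^ 2 + 12 * b ^ 4 - 144 * b ^ 6 + 2304 * b ^ 10 - 1 / 4 ≤ 0 := by
      have h10 : b ^ 10 ≤ (1 / 7) ^ 10 := by gcongr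
      have h6 : 0 ≤ b ^ 6 := by positivity
      norm_num at h10
      linarith
    nlinarith [mul_nonneg (pow_pos hb 5).le (neg_nonneg.mpr hneg)]
  by_contra! hlt
  have hcube := (Odd.strictMono_pow (R := ℝ) (n := 3) (by decide)) hlt
  simp only at hcube
  linarith

/-- If `Q ≥ 1` and `t ≥ 0` satisfies `(t+1)⁴ − t⁴ = Q`, then
`t ≥ −1/2 + 4^{−1/3}Q^{1/3} − (1/6)·2^{−1/3}Q^{−1/3} + (1/324)·4^{−1/3}Q^{−5/3}`. -/
theorem quartic_root_lower_bound (Q t : ℝ) (hQ : 1 ≤ Q) (ht : 0 ≤ t)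
    (h : (t + 1) ^ 4 - t ^ 4 = Q) :
    t ≥ -(1 / 2) + (4 : ℝ) ^ (-(1 : ℝ) / 3) * Q ^ ((1 : ℝ) / 3)
        - (1 / 6) * (2 : ℝ) ^ (-(1 : ℝ) / 3) * Q ^ (-(1 : ℝ) / 3)
        + (1 / 324) * (4 : ℝ) ^ (-(1 : ℝ) / 3) * Q ^ (-(5 : ℝ) / 3) := by
  have hQ0 : 0 < Q := by linarith
  obtain ⟨c, hc⟩ : ∃ c, c = (2 : ℝ) ^ (-(1 : ℝ) / 3) := ⟨_, rfl⟩
  obtain ⟨q, hq⟩ : ∃ q, q = Q ^ (-(1 : ℝ) / 3) := ⟨_, rfl⟩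
  have hc0 : 0 < c := hc ▸ by positivity
  have hq0 : 0 < q := hq ▸ by positivity
  have hc3 : c ^ 3 = 1 / 2 := by
    rw [hc, ← Real.rpow_natCast, ← Real.rpow_mul (by norm_num)]
    norm_num [Real.rpow_neg_one]
  have hq3 : q ^ 3 * Q = 1 := by
    rw [hq, ← Real.rpow_natCast, ← Real.rpow_mul hQ0.le]
    norm_num [Real.rpow_neg_one, hQ0.ne']
  have h4 : (4 : ℝ) ^ (-(1 : ℝ) / 3) = c ^ 2 := by
    rw [hc, show (4 : ℝ) = 2 * 2 by norm_num, Real.mul_rpow (by norm_num) (by norm_num), sq]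
  have hqinv : Q ^ ((1 : ℝ) / 3) = q⁻¹ := by
    rw [hq, ← Real.rpow_neg hQ0.le]
    norm_num
  have hq5 : Q ^ (-(5 : ℝ) / 3) = q ^ 5 := by
    rw [hq, ← Real.rpow_natCast, ← Real.rpow_mul hQ0.le]
    norm_num
  have hb7 : c * q / 6 ≤ 1 / 7 := by
    have hq1 : q ^ 3 ≤ 1 := by nlinarith [pow_pos hq0 3]
    have hcq : (c * q) ^ 3 ≤ (6 / 7) ^ 3 := by
      rw [mul_pow, hc3]
      norm_num
      linarith
    linarith [le_of_pow_le_pow_left₀ (by norm_num) (by norm_num) hcq]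
  have hab : c ^ 2 * q⁻¹ * (c * q / 6) = 1 / 12 := by
    field_simp
    linarith
  have hs : (t + 1 / 2) ^ 3 + (t + 1 / 2) / 4 = (c ^ 2 * q⁻¹) ^ 3 := by
    have hQq : q⁻¹ ^ 3 = Q := by
      field_simp
      linarith
    rw [mul_pow, hQq]
    linear_combination h / 4 - Q * (c ^ 3 + 1 / 2) * hc3
  have hmain := depressed_cubic_root_lower_bound (by positivity) hb7 hab hs
  have he : 48 * (c * q / 6) ^ 5 = 1 / 324 * c ^ 2 * q ^ 5 := by
    linear_combination c ^ 2 * q ^ 5 / 162 * hc3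
  rw [h4, hqinv, hq5, ← hc, ← hq]
  linarith
end

section
/- Let Q ≥ 1 be a real number and let t ≥ 0 satisfy (t+1)⁴ − t⁴ = Q. Then (t+1)⁶ − t⁶ ≥ (3/4)·2^{−1/3}·Q^{5/3} + (5/8)·Q − (11/24)·2^{−2/3}·Q^{1/3} + (659/10000)·Q^{−1/3}. -/
/-- A polynomial inequality that holds to third order at `v = 1`. -/
lemma polynomial_bound_near_one {v : ℝ} (hv : 1 ≤ v) (hv' : v ≤ 126 / 100) :
    0 ≤ (9 + 15 * (v ^ 3 - 1) - 6 * (v ^ 3 - 1) ^ 2) * v + 11 * (v ^ 3 - 1) ^ 2 * v ^ 2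
      - 9 * v ^ 6 - 399 / 100 * (v ^ 3 - 1) ^ 3 := by
  obtain ⟨d, rfl⟩ : ∃ d, v = 1 + d := ⟨v - 1, by ring⟩
  have hd : 0 ≤ d := by linarith
  have hd' : d ≤ 26 / 100 := by linarith
  have hpow (n : ℕ) : d ^ (n + 1) ≤ (26 / 100) ^ n * d := by
    rw [pow_succ]
    gcongr
  have h2 := hpow 1
  have h3 := hpow 2
  have h4 := hpow 3
  have h5 := hpow 4
  have h6 := hpow 5
  norm_num at h2 h3 h4 h5 h6
  have hP : 0 ≤ 627 / 100 + 1881 / 100 * d - 423 / 25 * d ^ 2 - 6619 / 100 * d ^ 3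
      - 1541 / 25 * d ^ 4 - 2491 / 100 * d ^ 5 - 399 / 100 * d ^ 6 := by
    linarith
  have := mul_nonneg (pow_nonneg hd 3) hP
  linarith

/-- The lower bound expressed through `s = 2 * t + 1` and the cube root `u` of `s ^ 3 + s`. -/
lemma quintic_lower_bound {s u : ℝ} (hs : 1 ≤ s) (hu : 0 < u) (h : u ^ 3 = s ^ 3 + s) :
    9 * u ^ 5 + 399 / 100 / u ≤ 9 * s ^ 5 + 15 * s ^ 3 - 6 * s + 11 * u := by
  have hs0 : 0 < s := by linarith
  obtain ⟨v, rfl⟩ : ∃ v, u = s * v := ⟨u / s, by field_simp⟩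
  have hv0 : 0 < v := pos_of_mul_pos_right hu hs0.le
  have hw : s ^ 2 * (v ^ 3 - 1) = 1 := by
    apply mul_left_cancel₀ hs0.ne'
    linear_combination h
  have hs2 : 1 ≤ s ^ 2 := one_le_pow₀ hs
  have hw0 : 0 < v ^ 3 - 1 := by
    by_contra! hneg
    nlinarith
  have hw1 : v ^ 3 - 1 ≤ 1 := by nlinarith
  have hv1 : 1 ≤ v := by
    by_contra! hlt
    have := pow_le_one₀ (n := 3) hv0.le hlt.le
    linarith
  have hv2 : v ≤ 126 / 100 := by
    apply le_of_pow_le_pow_left₀ (three_ne_zero) (by norm_num)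
    norm_num
    linarith
  have hP := mul_nonneg (pow_nonneg (sq_nonneg s) 3) (polynomial_bound_near_one hv1 hv2)
  have key : 9 * (s * v) ^ 6 + 399 / 100 ≤
      (9 * s ^ 5 + 15 * s ^ 3 - 6 * s + 11 * (s * v)) * (s * v) := by
    generalize v ^ 3 - 1 = w at *
    have e : (s ^ 2) ^ 3 * ((9 + 15 * w - 6 * w ^ 2) * v + 11 * w ^ 2 * v ^ 2
        - 9 * v ^ 6 - 399 / 100 * w ^ 3) =
        9 * s ^ 6 * v + 15 * s ^ 4 * (s ^ 2 * w) * v - 6 * s ^ 2 * (s ^ 2 * w) ^ 2 * v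
        + 11 * s ^ 2 * (s ^ 2 * w) ^ 2 * v ^ 2 - 9 * s ^ 6 * v ^ 6
        - 399 / 100 * (s ^ 2 * w) ^ 3 := by ring
    rw [e, hw] at hP
    linarith
  rw [← mul_le_mul_iff_of_pos_right hu, add_mul, div_mul_cancel₀ _ hu.ne']
  linarith

/-- If `Q ≥ 1` and `t ≥ 0` satisfies `(t+1)⁴ − t⁴ = Q`, then
`(t+1)⁶ − t⁶ ≥ (3/4)·2^{−1/3}Q^{5/3} + (5/8)Q − (11/24)·2^{−2/3}Q^{1/3} + (659/10000)Q^{−1/3}`. -/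
theorem sixth_power_lower_bound (Q t : ℝ) (hQ : 1 ≤ Q) (ht : 0 ≤ t)
    (h : (t + 1) ^ 4 - t ^ 4 = Q) :
    (t + 1) ^ 6 - t ^ 6 ≥
      (3 / 4) * (2 : ℝ) ^ (-(1 : ℝ) / 3) * Q ^ ((5 : ℝ) / 3) + (5 / 8) * Q
        - (11 / 24) * (2 : ℝ) ^ (-(2 : ℝ) / 3) * Q ^ ((1 : ℝ) / 3)
        + (659 / 10000) * Q ^ (-(1 : ℝ) / 3) := by
  have hQ0 : 0 < Q := by linarith
  have rpow_third (x : ℝ) (hx : 0 < x) (n : ℤ) : x ^ ((n : ℝ) / 3) = (x ^ ((1 : ℝ) / 3)) ^ n := by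
    rw [← Real.rpow_intCast, ← Real.rpow_mul hx.le]
    ring_nf
  have e1 := rpow_third 2 two_pos (-1)
  have e2 := rpow_third 2 two_pos (-2)
  have e3 := rpow_third Q hQ0 5
  have e4 := rpow_third Q hQ0 (-1)
  have e5 := rpow_third 2 two_pos 3
  have e6 := rpow_third Q hQ0 3
  push_cast at e1 e2 e3 e4 e5 e6
  rw [e1, e2, e3, e4]
  rw [div_self three_ne_zero, Real.rpow_one] at e5 e6
  have hc : 0 < (2 : ℝ) ^ ((1 : ℝ) / 3) := by positivity
  have hq : 0 < Q ^ ((1 : ℝ) / 3) := by positivity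
  generalize (2 : ℝ) ^ ((1 : ℝ) / 3) = c at *
  generalize Q ^ ((1 : ℝ) / 3) = q at *
  replace e5 : c ^ 3 = 2 := by exact_mod_cast e5.symm
  replace e6 : q ^ 3 = Q := by exact_mod_cast e6.symm
  have hc' : c ≤ 126 / 100 := by
    apply le_of_pow_le_pow_left₀ (three_ne_zero) (by norm_num)
    rw [e5]
    norm_num
  have hb := quintic_lower_bound (s := 2 * t + 1) (u := c * q) (by linarith) (by positivity)
    (by rw [mul_pow, e5, e6, ← h]; ring)
  have i1 : c ^ (-1 : ℤ) = c ^ 2 / 2 := by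
    rw [zpow_neg_one, ← e5]
    field_simp
  have i2 : c ^ (-2 : ℤ) = c / 2 := by
    rw [zpow_neg, ← e5]
    norm_cast
    field_simp
  have i3 : q ^ (5 : ℤ) = q ^ 5 := by norm_cast
  have i4 : 48 * (659 / 10000) * q ^ (-1 : ℤ) ≤ 399 / 100 / (c * q) := by
    rw [zpow_neg_one, le_div_iff₀ (by positivity)]
    have : 48 * (659 / 10000) * q⁻¹ * (c * q) = 48 * (659 / 10000) * c := by field_simp
    linarith
  have i5 : (c * q) ^ 5 = 2 * c ^ 2 * q ^ 5 := by
    rw [← e5]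
    ring
  rw [i1, i2, i3]
  rw [i5] at hb
  linarith
end

section
/- Let Q ≥ 1 be a real number and let t ≥ 0 satisfy (t+1)⁴ − t⁴ = Q. Then (t+1)⁸ − t⁸ ≥ (1/2)·2^{−2/3}·Q^{7/3} + (7/6)·2^{−1/3}·Q^{5/3} − (7/24)·Q + (23/324)·2^{−2/3}·Q^{1/3}. -/
/-- With `s ^ 2 * (4 * ((1 + y) ^ 3 - 1)) = 1`, the deficit of the bound is `s ^ 6 * y ^ 4` times a
polynomial in `y` that is nonnegative on `[0, 1]`. -/
theorem sextic_le_of_cube_eq {s y : ℝ} (hy0 : 0 ≤ y) (hy1 : y ≤ 1)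
    (h : 4 * s ^ 2 * ((1 + y) ^ 3 - 1) = 1) :
    2 * (s * (1 + y)) ^ 6 + 7 / 3 * (s * (1 + y)) ^ 4 - 7 / 24 * (s * (1 + y)) ^ 2 + 23 / 1296
      ≤ (s * (1 + y)) ^ 2 * (2 * s ^ 4 + 3 * s ^ 2 + 1 / 8) := by
  have h2 : 16 * s ^ 4 * ((1 + y) ^ 3 - 1) ^ 2 = 1 := by
    linear_combination (4 * s ^ 2 * ((1 + y) ^ 3 - 1) + 1) * h
  have h3 : 64 * s ^ 6 * ((1 + y) ^ 3 - 1) ^ 3 = 1 := by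
    linear_combination 16 * s ^ 4 * ((1 + y) ^ 3 - 1) ^ 2 * h + h2
  have hpoly : 0 ≤ 1674 + 3348 * y + 2214 * y ^ 2 + 252 * y ^ 3 - 288 * y ^ 4 - 92 * y ^ 5 := by
    have h4 : y ^ 4 ≤ 1 := pow_le_one₀ hy0 hy1
    have h5 : y ^ 5 ≤ 1 := pow_le_one₀ hy0 hy1
    have : 0 ≤ y ^ 2 := by positivity
    have : 0 ≤ y ^ 3 := by positivity
    linarith
  have hnn : 0 ≤ s ^ 6 * y ^ 4 *
      (1674 + 3348 * y + 2214 * y ^ 2 + 252 * y ^ 3 - 288 * y ^ 4 - 92 * y ^ 5) := by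
    positivity
  linear_combination hnn / 81 + (3 * s ^ 2 * (s * (1 + y)) ^ 2 - 7 / 3 * (s * (1 + y)) ^ 4) * h
    + (5 / 12) * (s * (1 + y)) ^ 2 * h2 - 23 / 1296 * h3

/-- The bound in terms of `u` with `4 * u ^ 3 = (t + 1) ^ 4 - t ^ 4`. -/
theorem le_eighth_power_sub_of_cube {t u : ℝ} (ht : 0 ≤ t) (hu : 0 < u)
    (h : (t + 1) ^ 4 - t ^ 4 = 4 * u ^ 3) :
    8 * u ^ 7 + 28 / 3 * u ^ 5 - 7 / 6 * u ^ 3 + 23 / 324 * u ≤ (t + 1) ^ 8 - t ^ 8 := by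
  obtain ⟨s, rfl⟩ : ∃ s, t = s - 1 / 2 := ⟨t + 1 / 2, by ring⟩
  have hs : 1 / 2 ≤ s := by linarith
  have hs0 : 0 < s := by linarith
  have hus : 4 * u ^ 3 = 4 * s ^ 3 + s := by linear_combination -h
  obtain ⟨y, rfl⟩ : ∃ y, u = s * (1 + y) := ⟨u / s - 1, by field_simp; ring⟩
  have hcube : 4 * s ^ 2 * ((1 + y) ^ 3 - 1) = 1 :=
    mul_left_cancel₀ hs0.ne' (by linear_combination hus)
  have hw : 0 < 1 + y := pos_of_mul_pos_right hu hs0.le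
  have hx0 : 0 ≤ (1 + y) ^ 3 - 1 := by
    by_contra! hneg
    nlinarith [sq_nonneg s]
  have hx1 : (1 + y) ^ 3 ≤ 2 := by
    nlinarith [mul_nonneg (show 0 ≤ 4 * s ^ 2 - 1 by nlinarith) hx0]
  have hy0 : 0 ≤ y := by
    by_contra! hneg
    have : (1 + y) ^ 3 < 1 := pow_lt_one₀ hw.le (by linarith) (by norm_num)
    linarith
  have hy1 : y ≤ 1 := by nlinarith [pow_nonneg hy0 2, pow_nonneg hy0 3]
  have key := mul_le_mul_of_nonneg_left (sextic_le_of_cube_eq hy0 hy1 hcube)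
    (show 0 ≤ 4 * (s * (1 + y)) by positivity)
  linear_combination key + (2 * s ^ 4 + 3 * s ^ 2 + 1 / 8) * hus


/-- If `Q ≥ 1` and `t ≥ 0` satisfies `(t+1)⁴ − t⁴ = Q`, then
`(t+1)⁸ − t⁸ ≥ (1/2)·2^{−2/3}Q^{7/3} + (7/6)·2^{−1/3}Q^{5/3} − (7/24)Q + (23/324)·2^{−2/3}Q^{1/3}`. -/
theorem eighth_power_lower_bound (Q t : ℝ) (hQ : 1 ≤ Q) (ht : 0 ≤ t)
    (h : (t + 1) ^ 4 - t ^ 4 = Q) :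
    (t + 1) ^ 8 - t ^ 8 ≥
      (1 / 2) * (2 : ℝ) ^ (-(2 : ℝ) / 3) * Q ^ ((7 : ℝ) / 3)
        + (7 / 6) * (2 : ℝ) ^ (-(1 : ℝ) / 3) * Q ^ ((5 : ℝ) / 3)
        - (7 / 24) * Q
        + (23 / 324) * (2 : ℝ) ^ (-(2 : ℝ) / 3) * Q ^ ((1 : ℝ) / 3) := by
  have hQ0 : 0 < Q := by linarith
  have rpow_third {x r : ℝ} (n : ℕ) (hx : 0 < x) (hr : r = n / 3) :
      x ^ r = (x ^ ((1 : ℝ) / 3)) ^ n := by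
    rw [← Real.rpow_mul_natCast hx.le, hr]
    ring_nf
  have hb1 : (2 : ℝ) ^ (-(1 : ℝ) / 3) = (1 / 2 : ℝ) ^ ((1 : ℝ) / 3) := by
    rw [one_div (2 : ℝ), Real.inv_rpow (by norm_num), ← Real.rpow_neg (by norm_num), neg_div]
  have hb2 : (2 : ℝ) ^ (-(2 : ℝ) / 3) = ((1 / 2 : ℝ) ^ ((1 : ℝ) / 3)) ^ 2 := by
    rw [← rpow_third (r := 2 / 3) 2 (by norm_num) (by norm_num), one_div (2 : ℝ),
      Real.inv_rpow (by norm_num), ← Real.rpow_neg (by norm_num), neg_div]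
  have hb3 : ((1 / 2 : ℝ) ^ ((1 : ℝ) / 3)) ^ 3 = 1 / 2 := by
    rw [← rpow_third (r := 1) 3 (by norm_num) (by norm_num), Real.rpow_one]
  have hq3 : (Q ^ ((1 : ℝ) / 3)) ^ 3 = Q := by
    rw [← rpow_third (r := 1) 3 hQ0 (by norm_num), Real.rpow_one]
  rw [hb1, hb2, rpow_third (r := 7 / 3) 7 hQ0 (by norm_num),
    rpow_third (r := 5 / 3) 5 hQ0 (by norm_num)]
  have hb0 : 0 < (1 / 2 : ℝ) ^ ((1 : ℝ) / 3) := by positivity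
  have hq0 : 0 < Q ^ ((1 : ℝ) / 3) := by positivity
  generalize (1 / 2 : ℝ) ^ ((1 : ℝ) / 3) = b at *
  generalize Q ^ ((1 : ℝ) / 3) = q at *
  have hb6 : b ^ 6 = 1 / 4 := by linear_combination (b ^ 3 + 1 / 2) * hb3
  have hb9 : b ^ 9 = 1 / 8 := by linear_combination b ^ 6 * hb3 + hb6 / 2
  have hb12 : b ^ 12 = 1 / 16 := by linear_combination b ^ 9 * hb3 + hb9 / 2
  have key := le_eighth_power_sub_of_cube (u := b ^ 2 * q) ht (by positivity)
    (by linear_combination h - hq3 - 4 * q ^ 3 * hb6)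
  linear_combination key - 8 * b ^ 2 * q ^ 7 * hb12 - 28 / 3 * b * q ^ 5 * hb9
    + 7 / 6 * q ^ 3 * hb6 + 7 / 24 * hq3
end

section
/- Let Q ≥ 2275 be a real number and let η ≥ 0 satisfy (η+1)⁵ − η⁵ = Q. Then (η+1)⁷ − η⁷ ≥ 7·(Q/5)^{3/2} + (7/2)·(Q/5) − (49/40)·(Q/5)^{1/2} + 141/512 + (7/100)·(Q/5)^{−1/4} − (3143/81920)·(Q/5)^{−1/2}. -/
/-- If `w = s⁻¹` is small, then `√(s² + 1/20)` is at least `s + w / 40 - w³ / 3200`. -/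
theorem add_sub_le_of_sq_eq_sq_add {s w u : ℝ} (hw : 0 < w) (hw1 : w ≤ 1) (hsw : s * w = 1)
    (hu : 0 ≤ u) (h : u ^ 2 = s ^ 2 + 1 / 20) : s + w / 40 - w ^ 3 / 3200 ≤ u := by
  refine abs_le_of_sq_le_sq' ?_ hu |>.2
  have key : (s + w / 40 - w ^ 3 / 3200) ^ 2 =
      s ^ 2 + 1 / 20 - w ^ 4 / 64000 * (1 - w ^ 2 / 160) := by
    linear_combination (1 / 20 - w ^ 2 / 1600) * hsw
  have hw2 : w ^ 2 ≤ 1 := pow_le_one₀ hw.le hw1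
  rw [key, h]
  have : 0 ≤ w ^ 4 / 64000 * (1 - w ^ 2 / 160) := mul_nonneg (by positivity) (by linarith)
  linarith


/-- If `Q ≥ 2275` and `η ≥ 0` satisfies `(η+1)⁵ − η⁵ = Q`, then
`(η+1)⁷ − η⁷ ≥ 7(Q/5)^{3/2} + (7/2)(Q/5) − (49/40)(Q/5)^{1/2} + 141/512
 + (7/100)(Q/5)^{−1/4} − (3143/81920)(Q/5)^{−1/2}`. -/
theorem seventh_power_lower_bound_dim4 (Q η : ℝ) (hQ : 2275 ≤ Q) (hη : 0 ≤ η)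
    (h : (η + 1) ^ 5 - η ^ 5 = Q) :
    (η + 1) ^ 7 - η ^ 7 ≥
      7 * (Q / 5) ^ ((3 : ℝ) / 2) + (7 / 2) * (Q / 5)
        - (49 / 40) * (Q / 5) ^ ((1 : ℝ) / 2) + 141 / 512
        + (7 / 100) * (Q / 5) ^ (-(1 : ℝ) / 4)
        - (3143 / 81920) * (Q / 5) ^ (-(1 : ℝ) / 2) := by
  obtain ⟨R, rfl⟩ : ∃ R, Q = 5 * R := ⟨Q / 5, by ring⟩
  rw [mul_div_cancel_left₀ R (by norm_num : (5 : ℝ) ≠ 0)]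
  have hR : 455 ≤ R := by linarith
  have hR0 : 0 ≤ R := by linarith
  have hquarter : R ^ (-(1 : ℝ) / 4) ≤ 1 / 4 := by
    calc R ^ (-(1 : ℝ) / 4) ≤ (256 : ℝ) ^ (-(1 : ℝ) / 4) :=
          Real.rpow_le_rpow_of_nonpos (by norm_num) (by linarith) (by norm_num)
      _ = 1 / 4 := by
          rw [show (256 : ℝ) = 4 ^ (4 : ℝ) by norm_num, ← Real.rpow_mul (by norm_num)]
          norm_num [Real.rpow_neg_one]
  have hthree : R ^ ((3 : ℝ) / 2) = (R ^ ((1 : ℝ) / 2)) ^ 3 := by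
    rw [← Real.rpow_natCast, ← Real.rpow_mul hR0]
    norm_num
  have hsq : (R ^ ((1 : ℝ) / 2)) ^ 2 = R := by
    rw [← Real.rpow_natCast, ← Real.rpow_mul hR0]
    norm_num
  have hinv : R ^ ((1 : ℝ) / 2) * R ^ (-(1 : ℝ) / 2) = 1 := by
    rw [← Real.rpow_add (by linarith)]
    norm_num
  have hs : 0 < R ^ ((1 : ℝ) / 2) := Real.rpow_pos_of_pos (by linarith) _
  have hw : 0 < R ^ (-(1 : ℝ) / 2) := Real.rpow_pos_of_pos (by linarith) _
  have hw1 : R ^ (-(1 : ℝ) / 2) ≤ 1 :=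
    Real.rpow_le_one_of_one_le_of_nonpos (by linarith) (by norm_num)
  rw [hthree]
  generalize R ^ ((1 : ℝ) / 2) = s at *
  generalize R ^ (-(1 : ℝ) / 2) = w at *
  generalize R ^ (-(1 : ℝ) / 4) = q at *
  obtain ⟨u, hu⟩ : ∃ u, u = (η + 1 / 2) ^ 2 + 1 / 4 := ⟨_, rfl⟩
  have husq : u ^ 2 = s ^ 2 + 1 / 20 := by
    rw [hu, hsq]
    linear_combination h / 5
  have hlow := add_sub_le_of_sq_eq_sq_add hw hw1 hinv (by rw [hu]; positivity) husq
  have hseventh : (η + 1) ^ 7 - η ^ 7 = u * (7 * s ^ 2 - 7 / 5) + 7 / 2 * s ^ 2 + 3 / 10 := by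
    have : (η + 1) ^ 7 - η ^ 7 = 7 * u ^ 3 + 7 / 2 * u ^ 2 - 7 / 4 * u + 1 / 8 := by
      rw [hu]
      ring
    rw [this]
    linear_combination (7 * u + 7 / 2) * husq
  have hmul := mul_le_mul_of_nonneg_right hlow (by linarith : 0 ≤ 7 * s ^ 2 - 7 / 5)
  have hexpand : (s + w / 40 - w ^ 3 / 3200) * (7 * s ^ 2 - 7 / 5) =
      7 * s ^ 3 - 49 / 40 * s - 119 / 3200 * w + 7 / 16000 * w ^ 3 := by
    linear_combination (7 / 40 * s - 7 / 3200 * w * (s * w + 1)) * hinv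
  have hw3 : 0 < w ^ 3 := pow_pos hw 3
  rw [hseventh, ← hsq]
  linarith
end

section
/- Let Q ≥ 2275 be a real number and let η ≥ 0 satisfy (η+1)⁵ − η⁵ = Q. Then (η+1)⁹ − η⁹ ≥ 9·(Q/5)² + 12·(Q/5)^{3/2} − (18/5)·(Q/5) + (549/640)·(Q/5)^{1/2} + (3/25)·(Q/5)^{1/4} − 17423/102400 + (21/200)·(Q/5)^{−1/4}. -/
theorem ninth_power_lower_bound_dim4 (Q η : ℝ) (hQ : 2275 ≤ Q) (hη : 0 ≤ η)
    (h : (η + 1) ^ 5 - η ^ 5 = Q) :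
    (η + 1) ^ 9 - η ^ 9 ≥
      9 * (Q / 5) ^ 2 + 12 * (Q / 5) ^ ((3 : ℝ) / 2) - (18 / 5) * (Q / 5)
        + (549 / 640) * (Q / 5) ^ ((1 : ℝ) / 2)
        + (3 / 25) * (Q / 5) ^ ((1 : ℝ) / 4)
        - 17423 / 102400
        + (21 / 200) * (Q / 5) ^ (-(1 : ℝ) / 4) := by
  have hq : 0 < Q / 5 := by linarith
  obtain ⟨t, ht⟩ : ∃ t, t = (Q / 5) ^ ((1 : ℝ) / 4) := ⟨_, rfl⟩
  have ht0 : 0 < t := ht ▸ Real.rpow_pos_of_pos hq _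
  have h4 : Q / 5 = t ^ 4 := by
    rw [ht, ← Real.rpow_mul_natCast hq.le]
    norm_num
  have h32 : (Q / 5) ^ ((3 : ℝ) / 2) = t ^ 6 := by
    rw [ht, ← Real.rpow_mul_natCast hq.le]
    norm_num
  have h12 : (Q / 5) ^ ((1 : ℝ) / 2) = t ^ 2 := by
    rw [ht, ← Real.rpow_mul_natCast hq.le]
    norm_num
  have hneg : (Q / 5) ^ (-(1 : ℝ) / 4) = t⁻¹ := by
    rw [ht, ← Real.rpow_neg hq.le]
    norm_num
  rw [h32, h12, hneg, ← ht, h4]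
  have ht4 : 4 ≤ t := by
    by_contra! hlt
    have : t ^ 4 < 4 ^ 4 := by gcongr
    linarith
  have hinv : t⁻¹ ≤ 1 / 4 := by
    rw [inv_le_comm₀ ht0 (by norm_num)]
    linarith
  -- In terms of `w`, both power differences become polynomials, with `w ^ 2 = t ^ 4 + 1 / 20`.
  obtain ⟨w, hw⟩ : ∃ w, w = (η + 1 / 2) ^ 2 + 1 / 4 := ⟨_, rfl⟩
  have hw0 : 0 ≤ w := by rw [hw]; positivity
  have hwt : w ^ 2 = t ^ 4 + 1 / 20 := by
    rw [← h4, ← h, hw]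
    ring
  have hcube : t ^ 6 + 3 / 40 * t ^ 2 ≤ w ^ 3 := by
    refine (sq_le_sq₀ (by positivity) (by positivity)).1 ?_
    have : (w ^ 3) ^ 2 = (t ^ 4 + 1 / 20) ^ 3 := by rw [← hwt]; ring
    rw [this]
    nlinarith [pow_pos ht0 4]
  have hF : (η + 1) ^ 9 - η ^ 9 = 9 * (w ^ 2) ^ 2 + 12 * w ^ 3 - 9 / 2 * w ^ 2 + 1 / 16 := by
    rw [hw]
    ring
  rw [hF, hwt]
  nlinarith [mul_nonneg (sub_nonneg.2 ht4) ht0.le]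
end

section
/- Let n ≥ 5 be an integer and let Q > 0 be a real number satisfying (Q/(n+1))^{2/n} ≥ (9375/(149·n·(n−1)³)) · max_{4 ≤ i ≤ n+1} C(n+1, i), where C(n+1, i) denotes the binomial coefficient. Let t ≥ 1/2 satisfy (t + 1/2)^{n+1} − (t − 1/2)^{n+1} = Q. Then t ≥ (Q/(n+1))^{1/n} − ((n−1)/24)·(Q/(n+1))^{−1/n}. -/
/-- The coefficients of the Lucas polynomials: `∑ m, lucasCoeff n m * z ^ m = g ^ n + (1 - g) ^ n`
whenever `z = g * (g - 1)`. -/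
def lucasCoeff : ℕ → ℕ → ℕ
  | 0, 0 => 2
  | 0, _ + 1 => 0
  | 1, 0 => 1
  | 1, _ + 1 => 0
  | n + 2, 0 => lucasCoeff (n + 1) 0
  | n + 2, m + 1 => lucasCoeff (n + 1) (m + 1) + lucasCoeff n m

theorem sum_lucasCoeff_mul_pow (g : ℝ) : ∀ n N : ℕ, n < N →
    ∑ m ∈ Finset.range N, (lucasCoeff n m : ℝ) * (g * (g - 1)) ^ m = g ^ n + (1 - g) ^ n
  | 0, N + 1, _ => by
    rw [Finset.sum_range_succ']
    norm_num [lucasCoeff]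
  | 1, N + 1, _ => by
    rw [Finset.sum_range_succ']
    simp [lucasCoeff]
  | n + 2, N + 1, h => by
    have h₁ := sum_lucasCoeff_mul_pow g (n + 1) (N + 1) (by omega)
    have h₀ := sum_lucasCoeff_mul_pow g n N (by omega)
    rw [Finset.sum_range_succ'] at h₁ ⊢
    have h₂ : ∑ m ∈ Finset.range N, (lucasCoeff (n + 2) (m + 1) : ℝ) * (g * (g - 1)) ^ (m + 1) =
        ∑ m ∈ Finset.range N, (lucasCoeff (n + 1) (m + 1) : ℝ) * (g * (g - 1)) ^ (m + 1) +
          g * (g - 1) * ∑ m ∈ Finset.range N, (lucasCoeff n m : ℝ) * (g * (g - 1)) ^ m := by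
      rw [Finset.mul_sum, ← Finset.sum_add_distrib]
      refine Finset.sum_congr rfl fun m _ => ?_
      rw [lucasCoeff]
      push_cast
      ring
    rw [h₂, h₀]
    rw [lucasCoeff]
    linear_combination h₁

theorem lucasCoeff_succ_zero : ∀ n : ℕ, lucasCoeff (n + 1) 0 = 1
  | 0 => by simp [lucasCoeff]
  | n + 1 => by rw [lucasCoeff, lucasCoeff_succ_zero n]

theorem lucasCoeff_eq_zero : ∀ n m : ℕ, n < 2 * m → lucasCoeff n m = 0
  | 0, m + 1, _ => by simp [lucasCoeff]
  | 1, m + 1, _ => by simp [lucasCoeff]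
  | n + 2, m + 1, h => by
    rw [lucasCoeff, lucasCoeff_eq_zero (n + 1) (m + 1) (by omega),
      lucasCoeff_eq_zero n m (by omega)]

theorem lucasCoeff_two_mul : ∀ m : ℕ, lucasCoeff (2 * m) m = 2
  | 0 => by simp [lucasCoeff]
  | m + 1 => by
    rw [show 2 * (m + 1) = 2 * m + 2 by ring, lucasCoeff, lucasCoeff_two_mul m,
      lucasCoeff_eq_zero _ _ (by omega)]

theorem lucasCoeff_mul_factorial : ∀ p m : ℕ, 0 < p + m →
    lucasCoeff (p + 2 * m) m * (m.factorial * p.factorial) =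
      (p + 2 * m) * (p + m - 1).factorial
  | 0, m + 1, _ => by
    rw [zero_add, lucasCoeff_two_mul, zero_add, Nat.add_sub_cancel, Nat.factorial_succ]
    simp
    ring
  | p + 1, 0, _ => by
    simp [lucasCoeff_succ_zero, Nat.factorial_succ]
  | p + 1, m + 1, _ => by
    have h₁ := lucasCoeff_mul_factorial p (m + 1) (by omega)
    have h₂ := lucasCoeff_mul_factorial (p + 1) m (by omega)
    rw [show p + 1 + 2 * (m + 1) = (p + 2 * m + 1) + 2 by ring, lucasCoeff]
    rw [show p + 2 * (m + 1) = p + 2 * m + 1 + 1 by ring,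
      show p + (m + 1) - 1 = p + m by omega] at h₁
    rw [show p + 1 + 2 * m = p + 2 * m + 1 by ring,
      show p + 1 + m - 1 = p + m by omega] at h₂
    rw [show p + 1 + (m + 1) - 1 = p + m + 1 by omega, Nat.factorial_succ (p + m)]
    rw [Nat.factorial_succ m] at h₁ ⊢
    rw [Nat.factorial_succ p] at h₂ ⊢
    linear_combination (p + 1) * h₁ + (m + 1) * h₂

theorem six_pow_mul_factorial_le (m : ℕ) : 6 ^ m * m.factorial ≤ (2 * m + 1).factorial := by
  induction m with
  | zero => simp
  | succ m ih =>
    rw [show 2 * (m + 1) + 1 = 2 * m + 1 + 1 + 1 by ring, Nat.factorial_succ (2 * m + 1 + 1),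
      Nat.factorial_succ (2 * m + 1), Nat.factorial_succ m, pow_succ]
    calc 6 ^ m * 6 * ((m + 1) * m.factorial) = (6 * (m + 1)) * (6 ^ m * m.factorial) := by ring
      _ ≤ ((2 * m + 1 + 1 + 1) * (2 * m + 1 + 1)) * (2 * m + 1).factorial :=
        Nat.mul_le_mul (by nlinarith) ih
      _ = _ := by ring

theorem two_mul_six_pow_mul_factorial_le (m : ℕ) (hm : 3 ≤ m) :
    2 * (6 ^ m * m.factorial) ≤ (2 * m + 1).factorial := by
  induction m, hm using Nat.le_induction with
  | base => decide
  | succ m _ ih =>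
    rw [show 2 * (m + 1) + 1 = 2 * m + 1 + 1 + 1 by ring, Nat.factorial_succ (2 * m + 1 + 1),
      Nat.factorial_succ (2 * m + 1), Nat.factorial_succ m, pow_succ]
    calc 2 * (6 ^ m * 6 * ((m + 1) * m.factorial))
        = (6 * (m + 1)) * (2 * (6 ^ m * m.factorial)) := by ring
      _ ≤ ((2 * m + 1 + 1 + 1) * (2 * m + 1 + 1)) * (2 * m + 1).factorial :=
        Nat.mul_le_mul (by nlinarith) ih
      _ = _ := by ring

/-- Comparison of an odd binomial coefficient with a Lucas coefficient, with a factor `c` of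
slack whenever `6 ^ m * m!` is smaller than `(2 * m + 1)!` by that factor. -/
theorem mul_choose_mul_six_pow_le (c n m : ℕ) (hn : 0 < n)
    (hc : c * (6 ^ m * m.factorial) ≤ (2 * m + 1).factorial) :
    c * ((n + 1).choose (2 * m + 1) * 6 ^ m) ≤ (n + 1) * lucasCoeff n m * (n - 1) ^ m := by
  rcases lt_or_ge n (2 * m) with h | h
  · rw [Nat.choose_eq_zero_of_lt (by omega)]
    simp
  obtain ⟨p, rfl⟩ : ∃ p, n = p + 2 * m := ⟨n - 2 * m, by omega⟩
  have h₁ := lucasCoeff_mul_factorial p m (by omega)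
  have h₂ := Nat.choose_mul_factorial_mul_factorial
    (show 2 * m + 1 ≤ p + 2 * m + 1 by omega)
  rw [show p + 2 * m + 1 - (2 * m + 1) = p by omega] at h₂
  have h₃ := Nat.factorial_mul_descFactorial (show m ≤ p + 2 * m - 1 by omega)
  rw [show p + 2 * m - 1 - m = p + m - 1 by omega] at h₃
  have h₄ := Nat.descFactorial_le_pow (p + 2 * m - 1) m
  have h₅ : (p + 2 * m + 1).factorial =
      (p + 2 * m + 1) * ((p + 2 * m) * (p + 2 * m - 1).factorial) := by
    rw [Nat.factorial_succ, Nat.mul_factorial_pred (by omega)]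
  set q := p + 2 * m - 1
  refine Nat.le_of_mul_le_mul_right (c := (2 * m + 1).factorial * p.factorial * m.factorial) ?_
    (by positivity)
  calc c * ((p + 2 * m + 1).choose (2 * m + 1) * 6 ^ m) *
        ((2 * m + 1).factorial * p.factorial * m.factorial)
      = (c * (6 ^ m * m.factorial)) *
        ((p + 2 * m + 1).choose (2 * m + 1) * (2 * m + 1).factorial * p.factorial) := by ring
    _ = (c * (6 ^ m * m.factorial)) * ((p + 2 * m + 1) * ((p + 2 * m) *
        ((p + m - 1).factorial * q.descFactorial m))) := by rw [h₂, h₅, h₃]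
    _ ≤ (2 * m + 1).factorial * ((p + 2 * m + 1) * ((p + 2 * m) *
        ((p + m - 1).factorial * q ^ m))) := by gcongr
    _ = (2 * m + 1).factorial * (p + 2 * m + 1) * q ^ m *
        ((p + 2 * m) * (p + m - 1).factorial) := by ring
    _ = _ := by rw [← h₁]; ring

theorem mul_choose_mul_pow_le (c n m : ℕ) (hn : 2 ≤ n)
    (hc : c * (6 ^ m * m.factorial) ≤ (2 * m + 1).factorial) {z : ℝ} (hz : 0 ≤ z) :
    c * (((n + 1).choose (2 * m + 1) : ℝ) * (6 * z / ((n : ℝ) - 1)) ^ m) ≤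
      ((n : ℝ) + 1) * (lucasCoeff n m * z ^ m) := by
  have h := mul_choose_mul_six_pow_le c n m (by omega) hc
  have hn' : (0 : ℝ) < (n : ℝ) - 1 := by
    have : (2 : ℝ) ≤ n := by exact_mod_cast hn
    linarith
  have h' : (c : ℝ) * ((n + 1).choose (2 * m + 1) * 6 ^ m) ≤
      ((n : ℝ) + 1) * lucasCoeff n m * ((n : ℝ) - 1) ^ m := by
    have : ((n - 1 : ℕ) : ℝ) = (n : ℝ) - 1 := by
      rw [Nat.cast_sub (by omega)]
      simp
    rw [← this]
    exact_mod_cast h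
  rw [div_pow, mul_pow, mul_div_assoc', mul_div_assoc', div_le_iff₀ (by positivity)]
  calc _ = (c : ℝ) * ((n + 1).choose (2 * m + 1) * 6 ^ m) * z ^ m := by ring
    _ ≤ ((n : ℝ) + 1) * lucasCoeff n m * ((n : ℝ) - 1) ^ m * z ^ m := by gcongr
    _ = _ := by ring

theorem sum_choose_mul_pow_le (n : ℕ) (hn : 5 ≤ n) {g : ℝ} (hg : 1 ≤ g) :
    ∑ m ∈ Finset.range (n + 1),
      ((n + 1).choose (2 * m + 1) : ℝ) * (6 * (g * (g - 1)) / ((n : ℝ) - 1)) ^ m ≤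
        ((n : ℝ) + 1) * g ^ n := by
  have hz : 0 ≤ g * (g - 1) := mul_nonneg (by linarith) (by linarith)
  have hsum := sum_lucasCoeff_mul_pow g n (n + 1) (by omega)
  have hle (m : ℕ) := mul_choose_mul_pow_le 1 n m (by omega)
    (by simpa using six_pow_mul_factorial_le m) hz
  simp only [Nat.cast_one, one_mul] at hle
  rcases Nat.even_or_odd n with hev | hodd
  · obtain ⟨M, hM⟩ := hev
    have hM2 : n = 2 * M := by omega
    have htop := mul_choose_mul_pow_le 2 n M (by omega)
      (two_mul_six_pow_mul_factorial_le M (by omega)) hz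
    have hluc : lucasCoeff n M = 2 := by rw [hM2, lucasCoeff_two_mul]
    have hsingle := Finset.single_le_sum
      (f := fun m => ((n : ℝ) + 1) * (lucasCoeff n m * (g * (g - 1)) ^ m) -
        ((n + 1).choose (2 * m + 1) : ℝ) * (6 * (g * (g - 1)) / ((n : ℝ) - 1)) ^ m)
      (fun m _ => sub_nonneg.2 (hle m)) (Finset.mem_range.2 (show M < n + 1 by omega))
    rw [Finset.sum_sub_distrib, ← Finset.mul_sum, hsum] at hsingle
    rw [hluc] at htop hsingle
    have hpow : (1 - g) ^ n ≤ (g * (g - 1)) ^ M := by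
      rw [hM2, pow_mul]
      exact pow_le_pow_left₀ (sq_nonneg _) (by nlinarith) M
    have hpow' := mul_le_mul_of_nonneg_left hpow (show (0 : ℝ) ≤ (n : ℝ) + 1 by positivity)
    push_cast at htop hsingle
    linarith
  · have hneg : (1 - g) ^ n ≤ 0 := hodd.pow_nonpos (by linarith)
    calc _ ≤ ∑ m ∈ Finset.range (n + 1), ((n : ℝ) + 1) * (lucasCoeff n m * (g * (g - 1)) ^ m) :=
          Finset.sum_le_sum fun m _ => hle m
      _ = ((n : ℝ) + 1) * (g ^ n + (1 - g) ^ n) := by rw [← Finset.mul_sum, hsum]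
      _ ≤ _ := by gcongr; linarith

theorem one_add_pow_sub_one_sub_pow (N : ℕ) (x : ℝ) :
    (1 + x) ^ N - (1 - x) ^ N =
      2 * x * ∑ m ∈ Finset.range N, (N.choose (2 * m + 1) : ℝ) * (x ^ 2) ^ m := by
  have hexp (y : ℝ) : (1 + y) ^ N =
      ∑ m ∈ Finset.range N, ((N.choose (2 * m) : ℝ) * y ^ (2 * m) +
        N.choose (2 * m + 1) * y ^ (2 * m + 1)) + if N = 0 then 1 else 0 := by
    have hsplit (f : ℕ → ℝ) (K : ℕ) : ∑ i ∈ Finset.range (2 * K), f i =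
        ∑ m ∈ Finset.range K, (f (2 * m) + f (2 * m + 1)) := by
      induction K with
      | zero => simp
      | succ K ih =>
        rw [show 2 * (K + 1) = 2 * K + 1 + 1 by ring, Finset.sum_range_succ,
          Finset.sum_range_succ, Finset.sum_range_succ, ih]
        ring
    rcases Nat.eq_zero_or_pos N with rfl | hN
    · simp
    rw [← hsplit fun i => (N.choose i : ℝ) * y ^ i, if_neg hN.ne', add_zero, add_comm 1 y, add_pow]
    simp only [one_pow, mul_one]
    rw [Finset.sum_congr rfl fun i _ => mul_comm (y ^ i) (N.choose i : ℝ)]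
    refine Finset.sum_subset (Finset.range_mono (by omega)) fun i _ hi => ?_
    rw [Nat.choose_eq_zero_of_lt (by simpa using hi)]
    simp
  rw [sub_eq_add_neg 1 x, hexp, hexp, add_sub_add_right_eq_sub, ← Finset.sum_sub_distrib,
    Finset.mul_sum]
  refine Finset.sum_congr rfl fun m _ => ?_
  rw [(even_two_mul m).neg_pow, (odd_two_mul_add_one m).neg_pow]
  ring

theorem add_half_pow_sub_sub_half_pow_lt (n : ℕ) (hn : 0 < n) {t u : ℝ} (ht : 1 / 2 ≤ t)
    (htu : t < u) :
    (t + 1 / 2) ^ (n + 1) - (t - 1 / 2) ^ (n + 1) <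
      (u + 1 / 2) ^ (n + 1) - (u - 1 / 2) ^ (n + 1) := by
  have hsum (x : ℝ) : (x + 1 / 2) ^ (n + 1) - (x - 1 / 2) ^ (n + 1) =
      ∑ i ∈ Finset.range (n + 1), (x + 1 / 2) ^ i * (x - 1 / 2) ^ (n + 1 - 1 - i) := by
    rw [← geom_sum₂_mul]
    ring
  rw [hsum, hsum]
  have h0 : 0 ≤ t - 1 / 2 := by linarith
  have h1 : 0 ≤ u + 1 / 2 := by linarith
  refine Finset.sum_lt_sum (fun i _ => by gcongr) ⟨n, by simp, ?_⟩
  simp only [Nat.add_sub_cancel, Nat.sub_self, pow_zero, mul_one]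
  exact pow_lt_pow_left₀ (by linarith) (by linarith) hn.ne'

theorem add_half_pow_sub_sub_half_pow_le (n : ℕ) (hn : 5 ≤ n) {k : ℝ} (hk : 0 < k)
    (hu : 0 < k - ((n : ℝ) - 1) / 24 * k⁻¹) :
    (k - ((n : ℝ) - 1) / 24 * k⁻¹ + 1 / 2) ^ (n + 1) -
      (k - ((n : ℝ) - 1) / 24 * k⁻¹ - 1 / 2) ^ (n + 1) ≤ ((n : ℝ) + 1) * k ^ n := by
  have hn' : (0 : ℝ) < (n : ℝ) - 1 := by
    have : (5 : ℝ) ≤ n := by exact_mod_cast hn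
    linarith
  set u := k - ((n : ℝ) - 1) / 24 * k⁻¹ with hu_def
  have hku : k * (k - u) = ((n : ℝ) - 1) / 24 := by
    rw [hu_def]
    field_simp
    ring
  have hle : u ≤ k := by
    rw [hu_def]
    have : 0 < ((n : ℝ) - 1) / 24 * k⁻¹ := by positivity
    linarith
  have hg : 1 ≤ k / u := (one_le_div hu).2 hle
  have hx : 6 * (k / u * (k / u - 1)) / ((n : ℝ) - 1) = (1 / (2 * u)) ^ 2 := by
    have : k / u * (k / u - 1) = ((n : ℝ) - 1) / 24 / u ^ 2 := by
      rw [← hku]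
      field_simp
    rw [this]
    field_simp
    norm_num
  have h := sum_choose_mul_pow_le n hn hg
  rw [hx] at h
  have hp : u + 1 / 2 = u * (1 + 1 / (2 * u)) := by field_simp
  have hm : u - 1 / 2 = u * (1 - 1 / (2 * u)) := by field_simp
  rw [hp, hm, mul_pow, mul_pow, ← mul_sub, one_add_pow_sub_one_sub_pow]
  calc _ = u ^ n * ∑ m ∈ Finset.range (n + 1),
        ((n + 1).choose (2 * m + 1) : ℝ) * ((1 / (2 * u)) ^ 2) ^ m := by
        rw [← mul_assoc]
        congr 1
        field_simp
        ring
    _ ≤ u ^ n * (((n : ℝ) + 1) * (k / u) ^ n) := by gcongr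
    _ = _ := by
      rw [div_pow]
      field_simp

/-- Let `n ≥ 5` and let `Q > 0` satisfy
`(Q/(n+1))^{2/n} ≥ (9375/(149n(n−1)³)) · max_{4 ≤ i ≤ n+1} C(n+1,i)`.
If `t ≥ 1/2` solves `(t+1/2)^{n+1} − (t−1/2)^{n+1} = Q`, then
`t ≥ (Q/(n+1))^{1/n} − ((n−1)/24)(Q/(n+1))^{−1/n}`. -/
theorem high_dim_root_lower_bound (n : ℕ) (hn : 5 ≤ n) (Q : ℝ) (hQ : 0 < Q)
    (hk : (Q / ((n : ℝ) + 1)) ^ ((2 : ℝ) / n) ≥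
      (9375 / (149 * (n : ℝ) * ((n : ℝ) - 1) ^ 3)) *
        (((Finset.Icc 4 (n + 1)).sup fun i => Nat.choose (n + 1) i : ℕ) : ℝ))
    (t : ℝ) (ht : 1 / 2 ≤ t)
    (heq : (t + 1 / 2) ^ (n + 1) - (t - 1 / 2) ^ (n + 1) = Q) :
    t ≥ (Q / ((n : ℝ) + 1)) ^ ((1 : ℝ) / n)
        - (((n : ℝ) - 1) / 24) * (Q / ((n : ℝ) + 1)) ^ (-(1 : ℝ) / n) := by
  have hpos : 0 < Q / ((n : ℝ) + 1) := by positivity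
  rw [neg_div, Real.rpow_neg hpos.le]
  have hkpos : 0 < (Q / ((n : ℝ) + 1)) ^ ((1 : ℝ) / n) := Real.rpow_pos_of_pos hpos _
  have hkn : ((n : ℝ) + 1) * ((Q / ((n : ℝ) + 1)) ^ ((1 : ℝ) / n)) ^ n = Q := by
    rw [one_div, Real.rpow_inv_natCast_pow hpos.le (by omega)]
    field_simp
  generalize (Q / ((n : ℝ) + 1)) ^ ((1 : ℝ) / n) = k at hkpos hkn ⊢
  by_contra! hlt
  have h₁ := add_half_pow_sub_sub_half_pow_lt n (by omega) ht hlt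
  have h₂ := add_half_pow_sub_sub_half_pow_le n hn hkpos (by linarith)
  linarith
end

section
/- Let n ≥ 5 be an integer and let Q > 0 be a real number satisfying both (Q/(n+1))^{2/n} ≥ (9375/(149·n·(n−1)³)) · max_{4 ≤ i ≤ n+1} C(n+1, i) and (Q/(n+1))^{2/n} ≥ (50/(317·c̃₁)) · max_{6 ≤ i ≤ n+1} C(n+1, i), where c̃₁ = (n−1)(n−3)(2n+1)/576000000 and C(n+1, i) denotes the binomial coefficient. Let t ≥ 1/2 satisfy (t + 1/2)^{n+1} − (t − 1/2)^{n+1} = Q. Then t ≥ (Q/(n+1))^{1/n} − ((n−1)/24)·(Q/(n+1))^{−1/n} + (99999/100000)·((n−1)(n−3)(2n+1)/5760)·(Q/(n+1))^{−3/n}. -/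
lemma one_sub_pow_le_quadratic {d : ℝ} (h0 : 0 ≤ d) (h1 : d ≤ 1) (m : ℕ) :
    (1 - d) ^ m ≤ 1 - m * d + m * (m - 1) / 2 * d ^ 2 := by
  induction m with
  | zero => simp
  | succ m ih =>
    have hmm : (0 : ℝ) ≤ m * (m - 1) := by
      rcases Nat.eq_zero_or_pos m with h | h
      · simp [h]
      · have : (1 : ℝ) ≤ m := by exact_mod_cast h
        nlinarith
    have := mul_le_mul_of_nonneg_right ih (sub_nonneg.2 h1)
    have h3 : 0 ≤ (m * (m - 1) : ℝ) * d ^ 3 := by positivity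
    rw [pow_succ]
    push_cast
    nlinarith

lemma central_diff_pow_mono {t s : ℝ} (ht : 1 / 2 ≤ t) (hts : t ≤ s) (m : ℕ) :
    (t + 1 / 2) ^ m - (t - 1 / 2) ^ m ≤ (s + 1 / 2) ^ m - (s - 1 / 2) ^ m := by
  induction m with
  | zero => simp
  | succ m ih =>
    have h0 : (t - 1 / 2) ^ m ≤ (t + 1 / 2) ^ m :=
      pow_le_pow_left₀ (by linarith) (by linarith) m
    have h1 : (t + 1 / 2) ^ m ≤ (s + 1 / 2) ^ m :=
      pow_le_pow_left₀ (by linarith) (by linarith) m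
    have h2 : (t - 1 / 2) ^ m ≤ (s - 1 / 2) ^ m :=
      pow_le_pow_left₀ (by linarith) (by linarith) m
    have h3 : t * ((t + 1 / 2) ^ m - (t - 1 / 2) ^ m)
        ≤ s * ((s + 1 / 2) ^ m - (s - 1 / 2) ^ m) :=
      mul_le_mul hts ih (by linarith) (by linarith)
    rw [pow_succ, pow_succ, pow_succ, pow_succ]
    linarith

lemma central_diff_pow_strictMono {t s : ℝ} (ht : 1 / 2 ≤ t) (hts : t < s) {m : ℕ}
    (hm : m ≠ 0) :
    (t + 1 / 2) ^ (m + 1) - (t - 1 / 2) ^ (m + 1)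
      < (s + 1 / 2) ^ (m + 1) - (s - 1 / 2) ^ (m + 1) := by
  have h0 : (t - 1 / 2) ^ m ≤ (t + 1 / 2) ^ m :=
    pow_le_pow_left₀ (by linarith) (by linarith) m
  have h1 : (t + 1 / 2) ^ m < (s + 1 / 2) ^ m :=
    pow_lt_pow_left₀ (by linarith) (by linarith) hm
  have h2 : (t - 1 / 2) ^ m < (s - 1 / 2) ^ m :=
    pow_lt_pow_left₀ (by linarith) (by linarith) hm
  have h3 : t * ((t + 1 / 2) ^ m - (t - 1 / 2) ^ m)
      ≤ s * ((s + 1 / 2) ^ m - (s - 1 / 2) ^ m) :=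
    mul_le_mul hts.le (central_diff_pow_mono ht hts.le m) (by linarith) (by linarith)
  rw [pow_succ, pow_succ, pow_succ, pow_succ]
  linarith

lemma sum_geometric_le_two {p : ℝ} (h0 : 0 ≤ p) (h1 : p ≤ 1 / 2) (k : ℕ) :
    ∑ j ∈ Finset.range k, p ^ j ≤ 2 := by
  have h := geom_sum_mul p k
  have hs : 0 ≤ ∑ j ∈ Finset.range k, p ^ j := Finset.sum_nonneg fun j _ => pow_nonneg h0 j
  have := pow_nonneg h0 k
  nlinarith

/-- Binomial expansion of `(r + p) ^ m - (r - p) ^ m`, truncated after the fifth order. -/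
lemma add_pow_sub_sub_pow_le {r p M : ℝ} (hr0 : 0 ≤ r) (hr1 : r ≤ 1) (hp0 : 0 ≤ p)
    (hp1 : p ≤ 1 / 2) (k : ℕ)
    (hM : ∀ i, 6 ≤ i → i ≤ k + 6 → ((k + 6).choose i : ℝ) ≤ M) :
    (r + p) ^ (k + 6) - (r - p) ^ (k + 6) ≤
      2 * (k + 6) * r ^ (k + 5) * p + 2 * ((k + 6).choose 3) * r ^ (k + 3) * p ^ 3
        + 2 * ((k + 6).choose 5) * r ^ (k + 1) * p ^ 5 + 4 * M * p ^ 7 := by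
  have hM0 : 0 ≤ M := le_trans (by positivity) (hM 6 le_rfl (by omega))
  have expand : (r + p) ^ (k + 6) - (r - p) ^ (k + 6) =
      ∑ i ∈ Finset.range (7 + k),
        (1 - (-1) ^ i) * p ^ i * r ^ (k + 6 - i) * ((k + 6).choose i : ℝ) := by
    have e : 7 + k = k + 6 + 1 := by omega
    rw [add_comm r p, show r - p = -p + r by ring, add_pow, add_pow, ← Finset.sum_sub_distrib, e]
    refine Finset.sum_congr rfl fun i _ => ?_
    rw [neg_pow]
    ring
  have tail : ∑ j ∈ Finset.range k,
      (1 - (-1) ^ (7 + j)) * p ^ (7 + j) * r ^ (k + 6 - (7 + j)) * ((k + 6).choose (7 + j) : ℝ)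
        ≤ 4 * M * p ^ 7 := by
    calc _ ≤ ∑ j ∈ Finset.range k, 2 * M * p ^ 7 * p ^ j := by
          refine Finset.sum_le_sum fun j hj => ?_
          have hj' := Finset.mem_range.1 hj
          have a1 : (1 - (-1 : ℝ) ^ (7 + j)) ≤ 2 := by
            rcases neg_one_pow_eq_or ℝ (7 + j) with h | h <;> rw [h] <;> norm_num
          have a2 : r ^ (k + 6 - (7 + j)) ≤ 1 := pow_le_one₀ hr0 hr1
          have a3 := hM (7 + j) (by omega) (by omega)
          calc _ ≤ 2 * p ^ (7 + j) * 1 * M := by gcongr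
            _ = _ := by ring
      _ = 2 * M * p ^ 7 * ∑ j ∈ Finset.range k, p ^ j := by rw [Finset.mul_sum]
      _ ≤ 2 * M * p ^ 7 * 2 := by gcongr; exact sum_geometric_le_two hp0 hp1 k
      _ = _ := by ring
  rw [expand, Finset.sum_range_add]
  refine add_le_add (le_of_eq ?_) tail
  simp only [Finset.sum_range_succ, Finset.sum_range_zero, Nat.choose_one_right]
  rw [show k + 6 - 1 = k + 5 by omega, show k + 6 - 3 = k + 3 by omega,
    show k + 6 - 5 = k + 1 by omega]
  push_cast
  ring

lemma factorial_three_mul_choose_three (k : ℕ) :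
    (6 : ℝ) * ((k + 6).choose 3) = (k + 6) * (k + 5) * (k + 4) := by
  have h := Nat.descFactorial_eq_factorial_mul_choose (k + 6) 3
  simp only [Nat.descFactorial_succ, Nat.descFactorial_zero, Nat.factorial] at h
  rw [show k + 6 - 2 = k + 4 by omega, show k + 6 - 1 = k + 5 by omega,
    show k + 6 - 0 = k + 6 by omega] at h
  have h' : (((k + 4) * ((k + 5) * ((k + 6) * 1)) : ℕ) : ℝ) = _ := congrArg Nat.cast h
  push_cast at h'
  linarith

lemma factorial_five_mul_choose_five (k : ℕ) :
    (120 : ℝ) * ((k + 6).choose 5) = (k + 6) * (k + 5) * (k + 4) * (k + 3) * (k + 2) := by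
  have h := Nat.descFactorial_eq_factorial_mul_choose (k + 6) 5
  simp only [Nat.descFactorial_succ, Nat.descFactorial_zero, Nat.factorial] at h
  rw [show k + 6 - 4 = k + 2 by omega, show k + 6 - 3 = k + 3 by omega,
    show k + 6 - 2 = k + 4 by omega, show k + 6 - 1 = k + 5 by omega,
    show k + 6 - 0 = k + 6 by omega] at h
  have h' : (((k + 2) * ((k + 3) * ((k + 4) * ((k + 5) * ((k + 6) * 1)))) : ℕ) : ℝ) = _ :=
    congrArg Nat.cast h
  push_cast at h'
  linarith

lemma factorial_six_mul_choose_six (k : ℕ) :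
    (720 : ℝ) * ((k + 6).choose 6) =
      (k + 6) * (k + 5) * (k + 4) * (k + 3) * (k + 2) * (k + 1) := by
  have h := Nat.descFactorial_eq_factorial_mul_choose (k + 6) 6
  simp only [Nat.descFactorial_succ, Nat.descFactorial_zero, Nat.factorial] at h
  rw [show k + 6 - 5 = k + 1 by omega,
    show k + 6 - 4 = k + 2 by omega, show k + 6 - 3 = k + 3 by omega,
    show k + 6 - 2 = k + 4 by omega, show k + 6 - 1 = k + 5 by omega,
    show k + 6 - 0 = k + 6 by omega] at h
  have h' : (((k + 1) * ((k + 2) * ((k + 3) * ((k + 4) * ((k + 5) * ((k + 6) * 1))))) : ℕ) : ℝ)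
      = _ := congrArg Nat.cast h
  push_cast at h'
  linarith

/-- The cubic remainder is dominated by the slack in the quadratic coefficient. -/
lemma cubic_remainder_le {K M e : ℝ} (hK : 0 ≤ K) (he : 0 ≤ e)
    (hM : (K + 6) * (K + 5) * (K + 4) * (K + 3) * (K + 2) * (K + 1) ≤ 720 * M)
    (heM : 28800000000 * (M * e) ≤ 317 * ((K + 4) * (K + 2) * (2 * K + 11))) :
    e * ((K + 5) * (K + 4) * (K + 3) / 24 * ((K + 4) * (K + 2) * (2 * K + 11) / 5760)
      + (K + 5) * (K + 4) * (K + 3) * (K + 2) / 48 * ((K + 4) / 24) ^ 2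
      + M / (32 * (K + 6))) ≤
      1 / 100000 * (K + 5) * ((K + 4) * (K + 2) * (2 * K + 11) / 5760) := by
  have hM0 : 0 ≤ M := by
    have : 0 ≤ (K + 6) * (K + 5) * (K + 4) * (K + 3) * (K + 2) * (K + 1) := by positivity
    linarith
  have h1 : M / (32 * (K + 6)) ≤ 7 / 1000 * ((K + 5) * M) := by
    rw [div_le_iff₀ (by positivity)]
    nlinarith [mul_nonneg hM0 hK, mul_nonneg (mul_nonneg hM0 hK) hK]
  have h2 : (K + 4) * (7 * K + 31) ≤ 144 / 5 * ((K + 6) * (K + 5) * (K + 1)) := by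
    nlinarith [mul_nonneg hK hK, mul_nonneg (mul_nonneg hK hK) hK]
  have h3 : (K + 5) * (K + 4) * (K + 3) / 24 * ((K + 4) * (K + 2) * (2 * K + 11) / 5760)
      + (K + 5) * (K + 4) * (K + 3) * (K + 2) / 48 * ((K + 4) / 24) ^ 2
      ≤ 15 / 100 * ((K + 5) * M) := by
    calc _ = (K + 5) * ((K + 4) * (K + 3) * (K + 2)) / 138240 * ((K + 4) * (7 * K + 31)) := by
          ring
      _ ≤ (K + 5) * ((K + 4) * (K + 3) * (K + 2)) / 138240
          * (144 / 5 * ((K + 6) * (K + 5) * (K + 1))) := by gcongr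
      _ = 15 / 100 / 720 * (K + 5)
          * ((K + 6) * (K + 5) * (K + 4) * (K + 3) * (K + 2) * (K + 1)) := by ring
      _ ≤ 15 / 100 / 720 * (K + 5) * (720 * M) := by gcongr
      _ = _ := by ring
  have hc : 0 ≤ (K + 4) * (K + 2) * (2 * K + 11) := by positivity
  calc _ ≤ e * (157 / 1000 * ((K + 5) * M)) := by gcongr; linarith
    _ = 157 / 1000 / 28800000000 * (K + 5) * (28800000000 * (M * e)) := by ring
    _ ≤ 157 / 1000 / 28800000000 * (K + 5) * (317 * ((K + 4) * (K + 2) * (2 * K + 11))) := by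
        gcongr
    _ ≤ _ := by nlinarith [mul_nonneg hc (by linarith : 0 ≤ K + 5)]

lemma second_correction_small {K M e : ℝ} (hK : 0 ≤ K) (he : 0 ≤ e)
    (hM : (K + 6) * (K + 5) * (K + 4) * (K + 3) * (K + 2) * (K + 1) ≤ 720 * M)
    (heM : 28800000000 * (M * e) ≤ 317 * ((K + 4) * (K + 2) * (2 * K + 11))) :
    e * ((K + 2) * (2 * K + 11)) ≤ 1 := by
  have h1 : 40000000 * ((K + 4) * (K + 2)) * (e * ((K + 6) * (K + 5) * (K + 3) * (K + 1)))
      ≤ 317 * ((K + 4) * (K + 2) * (2 * K + 11)) := by nlinarith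
  have h2 : 40000000 * (e * ((K + 6) * (K + 5) * (K + 3) * (K + 1))) ≤ 317 * (2 * K + 11) := by
    have : 0 < (K + 4) * (K + 2) := by positivity
    refine le_of_mul_le_mul_left ?_ this
    linarith
  have hD : 0 < (K + 6) * (K + 5) * (K + 3) * (K + 1) := by positivity
  have h3 : (K + 2) * (2 * K + 11) ^ 2 ≤ 24 * ((K + 6) * (K + 5) * (K + 3) * (K + 1)) := by
    nlinarith [mul_nonneg hK hK, mul_nonneg (mul_nonneg hK hK) hK,
      mul_nonneg (mul_nonneg hK hK) (mul_nonneg hK hK)]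
  have h4 := mul_le_mul_of_nonneg_right h2 (by positivity : 0 ≤ (K + 2) * (2 * K + 11))
  refine le_of_mul_le_mul_left ?_ hD
  linarith

/-- The rescaled inequality for the quadratic majorants of the powers of `1 - d`. -/
lemma quadratic_majorant_le_one {K M e d : ℝ} (hK : 0 ≤ K) (he : 0 ≤ e)
    (hM : (K + 6) * (K + 5) * (K + 4) * (K + 3) * (K + 2) * (K + 1) ≤ 720 * M)
    (heM : 28800000000 * (M * e) ≤ 317 * ((K + 4) * (K + 2) * (2 * K + 11)))
    (hd0 : 0 ≤ d)
    (hd : d = (K + 4) / 24 * e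
      - 99999 / 100000 * ((K + 4) * (K + 2) * (2 * K + 11) / 5760) * e ^ 2) :
    (1 - (K + 5) * d + (K + 5) * (K + 4) / 2 * d ^ 2)
      + (K + 5) * (K + 4) / 24 * e * (1 - (K + 3) * d + (K + 3) * (K + 2) / 2 * d ^ 2)
      + (K + 5) * (K + 4) * (K + 3) * (K + 2) / 1920 * e ^ 2
      + M / (32 * (K + 6)) * e ^ 3 ≤ 1 := by
  have hc : 0 ≤ (K + 4) * (K + 2) * (2 * K + 11) / 5760 := by positivity
  have hda : d ≤ (K + 4) / 24 * e := by
    have : 0 ≤ (K + 4) * (K + 2) * (2 * K + 11) / 5760 * e ^ 2 := by positivity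
    linarith
  have hd2 : d ^ 2 ≤ ((K + 4) / 24 * e) ^ 2 := pow_le_pow_left₀ hd0 hda 2
  have hdl : (K + 4) / 24 * e - (K + 4) * (K + 2) * (2 * K + 11) / 5760 * e ^ 2 ≤ d := by
    have : 0 ≤ (K + 4) * (K + 2) * (2 * K + 11) / 5760 * e ^ 2 := by positivity
    linarith
  have hR := mul_le_mul_of_nonneg_left (cubic_remainder_le hK he hM heM) (sq_nonneg e)
  have t1 : (K + 5) * (K + 4) / 2 * d ^ 2
      ≤ (K + 5) * (K + 4) / 2 * ((K + 4) / 24 * e) ^ 2 := by gcongr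
  have t2 : (K + 5) * (K + 4) / 24 * e * (1 - (K + 3) * d + (K + 3) * (K + 2) / 2 * d ^ 2)
      ≤ (K + 5) * (K + 4) / 24 * e * (1 - (K + 3) * ((K + 4) / 24 * e
          - (K + 4) * (K + 2) * (2 * K + 11) / 5760 * e ^ 2)
        + (K + 3) * (K + 2) / 2 * ((K + 4) / 24 * e) ^ 2) := by gcongr
  have t3 : (K + 5) * d = (K + 5) * ((K + 4) / 24 * e
      - 99999 / 100000 * ((K + 4) * (K + 2) * (2 * K + 11) / 5760) * e ^ 2) := by rw [hd]
  generalize hT : M / (32 * (K + 6)) = T at *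
  linarith

/-- The claim after multiplying out the roots: `x` plays the role of `(Q / (n + 1)) ^ (1 / n)`
with `n = k + 5`. -/
lemma central_diff_pow_le_of_approx {k : ℕ} {x M s : ℝ} (hx : 0 < x)
    (hM : ∀ i, 6 ≤ i → i ≤ k + 6 → ((k + 6).choose i : ℝ) ≤ M)
    (hMx : 28800000000 * M ≤ 317 * (((k : ℝ) + 4) * (k + 2) * (2 * k + 11)) * x ^ 2)
    (hs : s = x - ((k : ℝ) + 4) / 24 * x⁻¹
      + 99999 / 100000 * (((k : ℝ) + 4) * (k + 2) * (2 * k + 11) / 5760) * x⁻¹ ^ 3)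
    (hs0 : 0 ≤ s) :
    (s + 1 / 2) ^ (k + 6) - (s - 1 / 2) ^ (k + 6) ≤ (k + 6) * x ^ (k + 5) := by
  have hK : (0 : ℝ) ≤ k := k.cast_nonneg
  obtain ⟨y, hy⟩ : ∃ y, y = x⁻¹ := ⟨_, rfl⟩
  have hy0 : 0 < y := hy ▸ inv_pos.2 hx
  have hxy : x * y = 1 := by rw [hy]; exact mul_inv_cancel₀ hx.ne'
  have hM6 : ((k : ℝ) + 6) * (k + 5) * (k + 4) * (k + 3) * (k + 2) * (k + 1) ≤ 720 * M := by
    rw [← factorial_six_mul_choose_six]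
    exact mul_le_mul_of_nonneg_left (hM 6 le_rfl (by omega)) (by norm_num)
  have heM : 28800000000 * (M * y ^ 2) ≤ 317 * (((k : ℝ) + 4) * (k + 2) * (2 * k + 11)) := by
    have := mul_le_mul_of_nonneg_right hMx (sq_nonneg y)
    calc _ = 28800000000 * M * y ^ 2 := by ring
      _ ≤ _ := this
      _ = 317 * (((k : ℝ) + 4) * (k + 2) * (2 * k + 11)) * (x * y) ^ 2 := by ring
      _ = _ := by rw [hxy]; ring
  have hsmall := second_correction_small hK (sq_nonneg y) hM6 heM
  obtain ⟨d, hd⟩ : ∃ d, d = ((k : ℝ) + 4) / 24 * y ^ 2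
      - 99999 / 100000 * (((k : ℝ) + 4) * (k + 2) * (2 * k + 11) / 5760) * (y ^ 2) ^ 2 :=
    ⟨_, rfl⟩
  have hsx : s = x * (1 - d) := by
    rw [hs, hd, ← hy]
    linear_combination (((k : ℝ) + 4) / 24 * y - 99999 / 100000
      * (((k : ℝ) + 4) * (k + 2) * (2 * k + 11) / 5760) * y ^ 3) * hxy
  have hd1 : d ≤ 1 := by
    have : 0 ≤ 1 - d := nonneg_of_mul_nonneg_right (hsx ▸ hs0) hx
    linarith
  have hd0 : 0 ≤ d := by
    have h : 0 ≤ ((k : ℝ) + 4) * y ^ 2 * (1 - y ^ 2 * ((k + 2) * (2 * k + 11))) :=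
      mul_nonneg (by positivity) (by linarith)
    have h' : 0 ≤ ((k : ℝ) + 4) * y ^ 2 := by positivity
    rw [hd]
    linarith
  have hyle : y ≤ 1 := by
    have h1 : 1 ≤ ((k : ℝ) + 2) * (2 * k + 11) := by nlinarith
    have h2 : y ^ 2 ≤ 1 := (le_mul_of_one_le_right (sq_nonneg y) h1).trans hsmall
    exact (sq_le_one_iff₀ hy0.le).1 h2
  have key := quadratic_majorant_le_one hK (sq_nonneg y) hM6 heM hd0 hd
  have q1 := one_sub_pow_le_quadratic hd0 hd1 (k + 5)
  have q2 := one_sub_pow_le_quadratic hd0 hd1 (k + 3)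
  have q3 : (1 - d) ^ (k + 1) ≤ 1 := pow_le_one₀ (by linarith) (by linarith)
  push_cast at q1 q2
  have bin := add_pow_sub_sub_pow_le (r := 1 - d) (p := y / 2) (by linarith) (by linarith)
    (by linarith) (by linarith) k hM
  have c3 : ((k + 6).choose 3 : ℝ) = (k + 6) * (k + 5) * (k + 4) / 6 := by
    linarith [factorial_three_mul_choose_three k]
  have c5 : ((k + 6).choose 5 : ℝ) = (k + 6) * (k + 5) * (k + 4) * (k + 3) * (k + 2) / 120 := by
    linarith [factorial_five_mul_choose_five k]
  rw [c3, c5] at bin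
  have hk6 : (0 : ℝ) < k + 6 := by positivity
  have bound : (1 - d) ^ (k + 5)
      + ((k : ℝ) + 5) * (k + 4) / 24 * y ^ 2 * (1 - d) ^ (k + 3)
      + ((k : ℝ) + 5) * (k + 4) * (k + 3) * (k + 2) / 1920 * (y ^ 2) ^ 2 * (1 - d) ^ (k + 1)
      + M / (32 * (k + 6)) * (y ^ 2) ^ 3 ≤ 1 := by
    refine le_trans ?_ key
    have u2 := mul_le_mul_of_nonneg_left q2
      (by positivity : 0 ≤ ((k : ℝ) + 5) * (k + 4) / 24 * y ^ 2)
    have u3 := mul_le_mul_of_nonneg_left q3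
      (by positivity : 0 ≤ ((k : ℝ) + 5) * (k + 4) * (k + 3) * (k + 2) / 1920 * (y ^ 2) ^ 2)
    linarith
  have scaled : (1 - d + y / 2) ^ (k + 6) - (1 - d - y / 2) ^ (k + 6) ≤ (k + 6) * y := by
    refine bin.trans ?_
    have hb := mul_le_mul_of_nonneg_left bound (by positivity : 0 ≤ ((k : ℝ) + 6) * y)
    have hT : M / (32 * ((k : ℝ) + 6)) * (k + 6) = M / 32 := by field_simp
    refine le_trans (le_of_eq ?_) (hb.trans_eq (mul_one _))
    linear_combination (-y ^ 7) * hT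
  have e1 : s + 1 / 2 = x * (1 - d + y / 2) := by linear_combination hsx - 1 / 2 * hxy
  have e2 : s - 1 / 2 = x * (1 - d - y / 2) := by linear_combination hsx + 1 / 2 * hxy
  rw [e1, e2, mul_pow, mul_pow, ← mul_sub]
  calc _ ≤ x ^ (k + 6) * ((k + 6) * y) := by gcongr
    _ = (k + 6) * x ^ (k + 5) * (x * y) := by ring
    _ = _ := by rw [hxy, mul_one]

/-- Let `n ≥ 5` and let `Q > 0` satisfy both
`(Q/(n+1))^{2/n} ≥ (9375/(149n(n−1)³)) · max_{4 ≤ i ≤ n+1} C(n+1,i)` and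
`(Q/(n+1))^{2/n} ≥ (50/(317c̃₁)) · max_{6 ≤ i ≤ n+1} C(n+1,i)`, where
`c̃₁ = (n−1)(n−3)(2n+1)/576000000`.
If `t ≥ 1/2` solves `(t+1/2)^{n+1} − (t−1/2)^{n+1} = Q`, then
`t ≥ (Q/(n+1))^{1/n} − ((n−1)/24)(Q/(n+1))^{−1/n}
  + (99999/100000)((n−1)(n−3)(2n+1)/5760)(Q/(n+1))^{−3/n}`. -/
theorem high_dim_root_lower_bound_refined (n : ℕ) (hn : 5 ≤ n) (Q : ℝ) (hQ : 0 < Q)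
    (hk₁ : (Q / ((n : ℝ) + 1)) ^ ((2 : ℝ) / n) ≥
      (9375 / (149 * (n : ℝ) * ((n : ℝ) - 1) ^ 3)) *
        (((Finset.Icc 4 (n + 1)).sup fun i => Nat.choose (n + 1) i : ℕ) : ℝ))
    (hk₂ : (Q / ((n : ℝ) + 1)) ^ ((2 : ℝ) / n) ≥
      (50 / (317 * (((n : ℝ) - 1) * ((n : ℝ) - 3) * (2 * (n : ℝ) + 1) / 576000000))) *
        (((Finset.Icc 6 (n + 1)).sup fun i => Nat.choose (n + 1) i : ℕ) : ℝ))
    (t : ℝ) (ht : 1 / 2 ≤ t)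
    (heq : (t + 1 / 2) ^ (n + 1) - (t - 1 / 2) ^ (n + 1) = Q) :
    t ≥ (Q / ((n : ℝ) + 1)) ^ ((1 : ℝ) / n)
        - (((n : ℝ) - 1) / 24) * (Q / ((n : ℝ) + 1)) ^ (-(1 : ℝ) / n)
        + (99999 / 100000) * (((n : ℝ) - 1) * ((n : ℝ) - 3) * (2 * (n : ℝ) + 1) / 5760)
            * (Q / ((n : ℝ) + 1)) ^ (-(3 : ℝ) / n) := by
  by_contra! hlt
  obtain ⟨k, rfl⟩ : ∃ k, n = k + 5 := ⟨n - 5, by omega⟩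
  have hK : (0 : ℝ) ≤ k := k.cast_nonneg
  have hn0 : ((k + 5 : ℕ) : ℝ) ≠ 0 := by positivity
  have hq : 0 < Q / (((k + 5 : ℕ) : ℝ) + 1) := by positivity
  obtain ⟨x, hxdef⟩ : ∃ x, x = (Q / (((k + 5 : ℕ) : ℝ) + 1)) ^ ((1 : ℝ) / (k + 5 : ℕ)) :=
    ⟨_, rfl⟩
  have hx : 0 < x := hxdef ▸ Real.rpow_pos_of_pos hq _
  have hpow (a : ℝ) : (Q / (((k + 5 : ℕ) : ℝ) + 1)) ^ (a / (k + 5 : ℕ)) = x ^ a := by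
    rw [hxdef, ← Real.rpow_mul hq.le]
    congr 1
    ring
  have hxn : x ^ (k + 5) = Q / (((k + 5 : ℕ) : ℝ) + 1) := by
    rw [hxdef, one_div]
    exact Real.rpow_inv_natCast_pow hq.le (by omega)
  have hx3 : x ^ (-(3 : ℝ)) = x⁻¹ ^ 3 := by
    rw [Real.rpow_neg hx.le, inv_pow]
    norm_cast
  rw [hpow, Real.rpow_two] at hk₂
  rw [hpow, hpow, hpow, Real.rpow_one, Real.rpow_neg_one, hx3] at hlt
  generalize hMdef :
    (((Finset.Icc 6 (k + 5 + 1)).sup fun i => Nat.choose (k + 5 + 1) i : ℕ) : ℝ) = M at hk₂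
  have hM : ∀ i, 6 ≤ i → i ≤ k + 6 → ((k + 6).choose i : ℝ) ≤ M := by
    intro i h6 hi
    rw [← hMdef]
    exact_mod_cast Finset.le_sup (f := fun i => Nat.choose (k + 5 + 1) i)
      (Finset.mem_Icc.2 ⟨h6, hi⟩)
  have a1 : ((k + 5 : ℕ) : ℝ) - 1 = k + 4 := by push_cast; ring
  have a3 : ((k + 5 : ℕ) : ℝ) - 3 = k + 2 := by push_cast; ring
  have a2 : 2 * ((k + 5 : ℕ) : ℝ) + 1 = 2 * k + 11 := by push_cast; ring
  have a4 : ((k + 5 : ℕ) : ℝ) + 1 = k + 6 := by push_cast; ring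
  rw [a1, a3, a2] at hk₂ hlt
  rw [a4] at hxn
  have hMx : 28800000000 * M ≤ 317 * (((k : ℝ) + 4) * (k + 2) * (2 * k + 11)) * x ^ 2 := by
    have hc : 0 < ((k : ℝ) + 4) * (k + 2) * (2 * k + 11) := by positivity
    rw [ge_iff_le, div_mul_eq_mul_div, div_le_iff₀ (by positivity)] at hk₂
    linarith
  have hle := central_diff_pow_le_of_approx hx hM hMx rfl (by linarith)
  have hlt' := central_diff_pow_strictMono ht hlt (m := k + 5) (by omega)
  have hQ' : ((k : ℝ) + 6) * x ^ (k + 5) = Q := by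
    rw [hxn]
    field_simp
  rw [heq] at hlt'
  linarith
end

section
/- Let n ≥ 1 be an integer and let Ω ⊆ ℝⁿ be a bounded measurable set with Lebesgue measure V = vol(Ω) > 0. Let ω_n denote the Lebesgue measure of the unit ball in ℝⁿ. Then the moment of inertia I(Ω) = ∫_Ω |x|² dx satisfies I(Ω) ≥ (n/(n+2)) · V · (V/ω_n)^{2/n}. -/
open MeasureTheory Module

section

variable {E : Type*} [NormedAddCommGroup E] [NormedSpace ℝ E] [FiniteDimensional ℝ E]
  [MeasurableSpace E] [BorelSpace E] (μ : Measure E) [μ.IsAddHaarMeasure]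

theorem integrableOn_norm_sq_of_isBounded {s : Set E} (hs : Bornology.IsBounded s) :
    IntegrableOn (fun x => ‖x‖ ^ 2) s μ := by
  have hc : IsCompact (closure s) := hs.isCompact_closure
  have hf : Continuous fun x : E => ‖x‖ ^ 2 := by fun_prop
  exact (hf.continuousOn.integrableOn_compact hc).mono_set subset_closure

theorem setIntegral_ball_norm_sq [Nontrivial E] {R : ℝ} (hR : 0 ≤ R) :
    ∫ x in Metric.ball (0 : E) R, ‖x‖ ^ 2 ∂μ =
      (finrank ℝ E : ℝ) / (finrank ℝ E + 2) * μ.real (Metric.ball 0 1) *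
        R ^ (finrank ℝ E + 2) := by
  have hd : 0 < finrank ℝ E := finrank_pos
  have hind : (Metric.ball (0 : E) R).indicator (fun x => ‖x‖ ^ 2) =
      fun x => (Set.Iio R).indicator (fun y : ℝ => y ^ 2) ‖x‖ := by
    ext x
    by_cases hx : ‖x‖ < R <;> simp [hx]
  have hradial : ∫ y in Set.Ioi (0 : ℝ), y ^ (finrank ℝ E - 1) •
      (Set.Iio R).indicator (fun y : ℝ => y ^ 2) y =
      R ^ (finrank ℝ E + 2) / (finrank ℝ E + 2) := by
    have hmul : (fun y : ℝ => y ^ (finrank ℝ E - 1) •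
        (Set.Iio R).indicator (fun y : ℝ => y ^ 2) y) =
        (Set.Iio R).indicator fun y => y ^ (finrank ℝ E + 1) := by
      ext y
      by_cases hy : y < R
      · simp only [Set.indicator_of_mem (Set.mem_Iio.2 hy), smul_eq_mul, ← pow_add]
        congr 1
        omega
      · simp [hy]
    rw [hmul, setIntegral_indicator measurableSet_Iio, Set.Ioi_inter_Iio,
      ← integral_Ioc_eq_integral_Ioo, ← intervalIntegral.integral_of_le hR, integral_pow]
    push_cast
    simp
    ring
  rw [← integral_indicator Metric.isOpen_ball.measurableSet, hind,
    integral_fun_norm_addHaar, hradial, nsmul_eq_mul, smul_eq_mul]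
  ring

/-- Among sets of given measure, the ball centred at the origin minimises the second moment. -/
theorem setIntegral_ball_norm_sq_le {s : Set E} (hs : MeasurableSet s)
    (hbdd : Bornology.IsBounded s) {R : ℝ} (hR : 0 ≤ R)
    (hvol : μ.real s = μ.real (Metric.ball 0 R)) :
    ∫ x in Metric.ball (0 : E) R, ‖x‖ ^ 2 ∂μ ≤ ∫ x in s, ‖x‖ ^ 2 ∂μ := by
  have hball : MeasurableSet (Metric.ball (0 : E) R) := Metric.isOpen_ball.measurableSet
  have hconst {t : Set E} (ht : Bornology.IsBounded t) : IntegrableOn (fun _ => R ^ 2) t μ :=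
    integrableOn_const ht.measure_lt_top.ne
  have hint {t : Set E} (ht : Bornology.IsBounded t) :
      IntegrableOn (fun x => ‖x‖ ^ 2 - R ^ 2) t μ :=
    (integrableOn_norm_sq_of_isBounded μ ht).sub (hconst ht)
  have hsub {t : Set E} (ht : Bornology.IsBounded t) :
      ∫ x in t, (‖x‖ ^ 2 - R ^ 2) ∂μ = ∫ x in t, ‖x‖ ^ 2 ∂μ - μ.real t * R ^ 2 := by
    rw [integral_sub (integrableOn_norm_sq_of_isBounded μ ht) (hconst ht), setIntegral_const,
      smul_eq_mul]
  have hle : ∫ x in Metric.ball (0 : E) R, (‖x‖ ^ 2 - R ^ 2) ∂μ ≤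
      ∫ x in s, (‖x‖ ^ 2 - R ^ 2) ∂μ := by
    rw [← integral_indicator hball, ← integral_indicator hs]
    refine integral_mono ((hint Metric.isBounded_ball).integrable_indicator hball)
      ((hint hbdd).integrable_indicator hs) fun x => ?_
    by_cases hx : ‖x‖ < R
    · have : ‖x‖ ^ 2 ≤ R ^ 2 := by gcongr
      rw [Set.indicator_of_mem (mem_ball_zero_iff.2 hx)]
      exact Set.le_indicator_apply (fun _ => le_rfl) fun _ => sub_nonpos.2 this
    · have : R ^ 2 ≤ ‖x‖ ^ 2 := by gcongr; exact not_lt.1 hx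
      rw [Set.indicator_of_notMem (by simpa using hx)]
      exact Set.indicator_apply_nonneg fun _ => sub_nonneg.2 this
  rw [hsub Metric.isBounded_ball, hsub hbdd, hvol] at hle
  linarith

end

/-- For a bounded measurable set `Ω ⊆ ℝⁿ` of positive volume `V`, the moment of
inertia `I(Ω) = ∫_Ω |x|² dx` satisfies `I(Ω) ≥ (n/(n+2)) · V · (V/ω_n)^{2/n}`,
where `ω_n` is the volume of the unit ball in `ℝⁿ`. -/
theorem moment_of_inertia_lower_bound (n : ℕ) (hn : 1 ≤ n)
    (Ω : Set (EuclideanSpace ℝ (Fin n)))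
    (hΩ_meas : MeasurableSet Ω) (hΩ_bdd : Bornology.IsBounded Ω)
    (hV : 0 < (volume Ω).toReal) :
    (∫ x in Ω, ‖x‖ ^ 2) ≥
      ((n : ℝ) / ((n : ℝ) + 2)) * (volume Ω).toReal *
        ((volume Ω).toReal /
          (volume (Metric.ball (0 : EuclideanSpace ℝ (Fin n)) 1)).toReal) ^ ((2 : ℝ) / n) := by
  have : NeZero n := ⟨by omega⟩
  have : Nontrivial (EuclideanSpace ℝ (Fin n)) :=
    Module.nontrivial_of_finrank_pos (R := ℝ) (by rw [finrank_euclideanSpace_fin]; omega)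
  set V := (volume Ω).toReal
  set ω := (volume (Metric.ball (0 : EuclideanSpace ℝ (Fin n)) 1)).toReal with hω
  have hω_pos : 0 < ω :=
    ENNReal.toReal_pos (Metric.measure_ball_pos _ _ one_pos).ne' measure_ball_lt_top.ne
  have hq : 0 ≤ V / ω := by positivity
  set R := (V / ω) ^ (1 / (n : ℝ)) with hR
  have hR_nonneg : 0 ≤ R := by positivity
  have hRn : R ^ n = V / ω := by
    rw [hR, one_div, Real.rpow_inv_natCast_pow hq (by omega)]
  have hR2 : R ^ 2 = (V / ω) ^ ((2 : ℝ) / n) := by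
    rw [hR, ← Real.rpow_mul_natCast hq]
    congr 1
    push_cast
    ring
  have hvol : volume.real Ω = volume.real (Metric.ball (0 : EuclideanSpace ℝ (Fin n)) R) := by
    rw [measureReal_def, measureReal_def, Measure.addHaar_ball _ _ hR_nonneg, ENNReal.toReal_mul,
      ENNReal.toReal_ofReal (by positivity), finrank_euclideanSpace_fin, hRn]
    exact (div_mul_cancel₀ V hω_pos.ne').symm
  have hle := setIntegral_ball_norm_sq_le volume hΩ_meas hΩ_bdd hR_nonneg hvol
  rw [setIntegral_ball_norm_sq volume hR_nonneg, finrank_euclideanSpace_fin, measureReal_def,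
    ← hω, pow_add, hRn, hR2] at hle
  refine le_trans (le_of_eq ?_) hle
  field_simp
end

section
/- Let n ≥ 1 be an integer and let q : [0,∞) → ℝ be a measurable function with 0 ≤ q(s) ≤ 1 for all s, ∫₀^∞ q(s) ds = 1, and ∫₀^∞ sⁿ q(s) ds < ∞. Then there exists a real number a ≥ 0 such that ((a+1)^{n+1} − a^{n+1})/(n+1) = ∫₀^∞ sⁿ q(s) ds, i.e. ∫_a^{a+1} sⁿ ds = ∫₀^∞ sⁿ q(s) ds. -/
open MeasureTheory Set

/-- First-order lower bound for the increment of a power on the nonnegative half-line. -/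
theorem pow_succ_add_mul_pow_le {x : ℝ} (hx : 0 ≤ x) (k : ℕ) :
    x ^ (k + 1) + ((k : ℝ) + 1) * x ^ k ≤ (x + 1) ^ (k + 1) := by
  induction k with
  | zero => simp
  | succ k ih =>
    have h1 : (x + 1) * (x ^ (k + 1) + ((k : ℝ) + 1) * x ^ k) ≤ (x + 1) * (x + 1) ^ (k + 1) :=
      mul_le_mul_of_nonneg_left ih (by linarith)
    have h2 : 0 ≤ ((k : ℝ) + 1) * x ^ k := by positivity
    push_cast
    calc x ^ (k + 1 + 1) + ((k : ℝ) + 1 + 1) * x ^ (k + 1)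
        ≤ (x + 1) * (x ^ (k + 1) + ((k : ℝ) + 1) * x ^ k) := by
          ring_nf at h2 ⊢
          linarith
      _ ≤ (x + 1) * (x + 1) ^ (k + 1) := h1
      _ = (x + 1) ^ (k + 1 + 1) := by ring

/-- Bathtub principle: among densities bounded by `1`, the uniform density on `[0,1]` minimizes
the `n`-th moment. -/
theorem one_div_le_integral_pow_mul (n : ℕ) (q : ℝ → ℝ)
    (hq_bd : ∀ s ∈ Ioi (0 : ℝ), 0 ≤ q s ∧ q s ≤ 1)
    (hq_int : ∫ s in Ioi (0 : ℝ), q s = 1)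
    (hq_mom : IntegrableOn (fun s : ℝ => s ^ n * q s) (Ioi (0 : ℝ))) :
    1 / ((n : ℝ) + 1) ≤ ∫ s in Ioi (0 : ℝ), s ^ n * q s := by
  have hq : IntegrableOn q (Ioi (0 : ℝ)) := by
    by_contra h
    rw [integral_undef h] at hq_int
    exact zero_ne_one hq_int
  have hsub : Ioc (0 : ℝ) 1 ⊆ Ioi 0 := Ioc_subset_Ioi_self
  have hind : IntegrableOn ((Ioc (0 : ℝ) 1).indicator fun s : ℝ => s ^ n - 1) (Ioi 0) := by
    have hc : Continuous fun s : ℝ => s ^ n - 1 := by fun_prop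
    exact ((integrable_indicator_iff measurableSet_Ioc).2
      (hc.integrableOn_Ioc (μ := volume))).integrableOn
  have hval : ∫ s in Ioi (0 : ℝ), (Ioc (0 : ℝ) 1).indicator (fun s : ℝ => s ^ n - 1) s
      = 1 / ((n : ℝ) + 1) - 1 := by
    rw [setIntegral_indicator measurableSet_Ioc, inter_eq_self_of_subset_right hsub,
      ← intervalIntegral.integral_of_le zero_le_one, intervalIntegral.integral_sub
        ((continuous_pow n).intervalIntegrable _ _) intervalIntegrable_const, integral_pow]
    simp
  have hle : ∫ s in Ioi (0 : ℝ), (Ioc (0 : ℝ) 1).indicator (fun s : ℝ => s ^ n - 1) s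
      ≤ ∫ s in Ioi (0 : ℝ), (s ^ n * q s - q s) := by
    refine setIntegral_mono_on hind (hq_mom.sub hq) measurableSet_Ioi fun s hs => ?_
    obtain ⟨h0, h1⟩ := hq_bd s hs
    have hs0 : 0 ≤ s := le_of_lt hs
    by_cases h : s ≤ 1
    · rw [indicator_of_mem (show s ∈ Ioc (0 : ℝ) 1 from ⟨hs, h⟩)]
      have := pow_le_one₀ (n := n) hs0 h
      nlinarith
    · rw [indicator_of_notMem fun hm => h hm.2]
      have := one_le_pow₀ (n := n) (le_of_lt (not_le.1 h))
      nlinarith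
  rw [integral_sub hq_mom hq, hval, hq_int] at hle
  linarith

/-- If `q : [0,∞) → ℝ` is measurable with `0 ≤ q ≤ 1`, `∫₀^∞ q = 1` and the `n`-th
moment of `q` is finite, then there is `a ≥ 0` with
`((a+1)^{n+1} − a^{n+1})/(n+1) = ∫₀^∞ sⁿ q(s) ds`, i.e.
`∫_a^{a+1} sⁿ ds = ∫₀^∞ sⁿ q(s) ds`. -/
theorem exists_comparison_interval (n : ℕ) (hn : 1 ≤ n) (q : ℝ → ℝ)
    (hq_meas : Measurable q)
    (hq_bd : ∀ s ∈ Ici (0 : ℝ), 0 ≤ q s ∧ q s ≤ 1)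
    (hq_int : ∫ s in Ioi (0 : ℝ), q s = 1)
    (hq_mom : IntegrableOn (fun s : ℝ => s ^ n * q s) (Ioi (0 : ℝ))) :
    ∃ a : ℝ, 0 ≤ a ∧
      ((a + 1) ^ (n + 1) - a ^ (n + 1)) / ((n : ℝ) + 1) =
        ∫ s in Ioi (0 : ℝ), s ^ n * q s := by
  have hlow := one_div_le_integral_pow_mul n q
    (fun s hs => hq_bd s (Ioi_subset_Ici_self hs)) hq_int hq_mom
  set m := ∫ s in Ioi (0 : ℝ), s ^ n * q s
  have hn0 : (0 : ℝ) < (n : ℝ) + 1 := by positivity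
  have hm : 0 ≤ m := le_trans (by positivity) hlow
  have hcont : ContinuousOn
      (fun a : ℝ => ((a + 1) ^ (n + 1) - a ^ (n + 1)) / ((n : ℝ) + 1)) (Icc 0 (m + 1)) := by
    fun_prop
  have hup : m ≤ ((m + 1 + 1) ^ (n + 1) - (m + 1) ^ (n + 1)) / ((n : ℝ) + 1) := by
    rw [le_div_iff₀ hn0]
    have h1 := pow_succ_add_mul_pow_le (show 0 ≤ m + 1 by linarith) n
    have h2 : m + 1 ≤ (m + 1) ^ n := le_self_pow₀ (by linarith) (by lia)
    nlinarith
  obtain ⟨a, ha, hav⟩ := intermediate_value_Icc (show 0 ≤ m + 1 by linarith) hcont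
    (show m ∈ Icc _ _ from ⟨by simpa using hlow, hup⟩)
  exact ⟨a, ha.1, hav⟩
end
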